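/- For every integer n ≥ 1 and every finite field F with q elements, the set of ideals I of the Laurent polynomial algebra A = F[x,y,x⁻¹,y⁻¹] (the group algebra of ℤ × ℤ over F, i.e. AddMonoidAlgebra F (ℤ × ℤ)) such that the F-vector space A/I has dimension n is finite, and its cardinality equals c_{n,0}·q^n + Σ_{i=1}^{n} c_{n,i}·(q^{n+i} + q^{n-i}). -/

import Mathlib

/-- The coefficients `c_{n,i}` from the paper: `c_{n,0} = 2(-1)^k` if `n = k(k+1)/2` for some
`k ≥ 1` and `0` otherwise; for `i ≥ 1`, `c_{n,i} = (-1)^k` if `n = k(k+2i+1)/2` for some `k ≥ 1`,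
`(-1)^(k-1)` if `n = k(k+2i-1)/2` for some `k ≥ 1`, and `0` otherwise.  (For each `n, i` at most
one `k` can occur in each case, so we may express the value as a finite sum.) -/
def cCoeff (n i : ℕ) : ℤ :=
  if i = 0 then
    ∑ k ∈ Finset.Icc 1 (2 * n), if 2 * n = k * (k + 1) then 2 * (-1 : ℤ) ^ k else 0
  else
    ∑ k ∈ Finset.Icc 1 (2 * n),
      ((if 2 * n = k * (k + 2 * i + 1) then (-1 : ℤ) ^ k else 0) +
        (if 2 * n = k * (k + 2 * i - 1) then (-1 : ℤ) ^ (k - 1) else 0))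

namespace LaurentCount
open Polynomial

section Structure
variable {R : Type*} [CommRing R]

/-- The ideal `e J + (f)`. -/
noncomputable def build (e : R) (J : Ideal R[X]) (f : R[X]) : Ideal R[X] :=
  Ideal.span {C e} * J ⊔ Ideal.span {f}

lemma mem_build {e : R} {J : Ideal R[X]} {f p : R[X]} :
    p ∈ build e J f ↔ ∃ j ∈ J, ∃ h, p = C e * j + f * h := by
  unfold build
  rw [Submodule.mem_sup]
  constructor
  · rintro ⟨y, hy, z, hz, rfl⟩
    obtain ⟨j, hj, rfl⟩ := Ideal.mem_span_singleton_mul.1 hy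
    obtain ⟨h, rfl⟩ := Ideal.mem_span_singleton.1 hz
    exact ⟨j, hj, h, rfl⟩
  · rintro ⟨j, hj, h, rfl⟩
    exact ⟨_, Ideal.mem_span_singleton_mul.2 ⟨j, hj, rfl⟩, _,
      Ideal.mem_span_singleton.2 ⟨h, rfl⟩, rfl⟩

lemma modByMonic_mem {J : Ideal R[X]} {f p : R[X]} (hfJ : f ∈ J) (hp : p ∈ J) :
    p %ₘ f ∈ J := by
  rw [modByMonic_eq_sub_mul_div]
  exact J.sub_mem hp (J.mul_mem_right _ hfJ)

lemma C_mul_modByMonic (e : R) (p f : R[X]) : (C e * p) %ₘ f = C e * (p %ₘ f) := by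
  rw [← smul_eq_C_mul, ← smul_eq_C_mul, smul_modByMonic]

lemma mul_add_modByMonic (f p h : R[X]) (hf : f.Monic) : (p + f * h) %ₘ f = p %ₘ f := by
  rw [add_modByMonic, (modByMonic_eq_zero_iff_dvd hf).2 (dvd_mul_right f h), add_zero]

lemma mem_build_iff [Nontrivial R] {e : R} {J : Ideal R[X]} {f : R[X]} (hf : f.Monic) (hfJ : f ∈ J)
    {p : R[X]} :
    p ∈ build e J f ↔ ∃ j ∈ J, degree j < degree f ∧ p %ₘ f = C e * j := by
  rw [mem_build]
  constructor
  · rintro ⟨j, hj, h, rfl⟩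
    refine ⟨j %ₘ f, modByMonic_mem hfJ hj, degree_modByMonic_lt _ hf, ?_⟩
    rw [mul_add_modByMonic _ _ _ hf, C_mul_modByMonic]
  · rintro ⟨j, hj, -, h⟩
    exact ⟨j, hj, p /ₘ f, by rw [← h, modByMonic_add_div]⟩

lemma build_congr {e : R} {J : Ideal R[X]} {f f' j : R[X]} (hj : j ∈ J) (h : f - f' = C e * j) :
    build e J f = build e J f' := by
  apply le_antisymm
  · intro p hp
    obtain ⟨j', hj', k, rfl⟩ := mem_build.1 hp
    refine mem_build.2 ⟨j' + j * k, J.add_mem hj' (J.mul_mem_right _ hj), k, ?_⟩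
    linear_combination k * h
  · intro p hp
    obtain ⟨j', hj', k, rfl⟩ := mem_build.1 hp
    refine mem_build.2 ⟨j' - j * k, J.sub_mem hj' (J.mul_mem_right _ hj), k, ?_⟩
    linear_combination -k * h

variable [IsDomain R]

lemma mem_of_C_mul_mem_build {e : R} (he : e ≠ 0) {J : Ideal R[X]} {f : R[X]} (hf : f.Monic)
    (hfJ : f ∈ J) {p : R[X]} : C e * p ∈ build e J f ↔ p ∈ J := by
  constructor
  · intro h
    obtain ⟨j, hj, -, h⟩ := (mem_build_iff hf hfJ).1 h
    rw [C_mul_modByMonic] at h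
    have := mul_left_cancel₀ (C_ne_zero.2 he) h
    rw [← modByMonic_add_div p f, this]
    exact J.add_mem hj (J.mul_mem_right _ hfJ)
  · intro h
    exact mem_build.2 ⟨p, h, 0, by simp⟩

lemma dvd_of_build_le {e e' : R} (he : e ≠ 0) {J J' : Ideal R[X]} {f f' g : R[X]} {m : ℕ}
    (hg : g.Monic) (hgm : g.natDegree = m) (hgJ : g ∈ J)
    (hf' : f'.Monic) (hfm' : f'.natDegree = m + 1) (hfJ' : f' ∈ J')
    (h : build e J f ≤ build e' J' f') : e' ∣ e := by
  have h1 : C e * g ∈ build e J f := mem_build.2 ⟨g, hgJ, 0, by simp⟩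
  obtain ⟨j, hj, -, h2⟩ := (mem_build_iff hf' hfJ').1 (h h1)
  have h3 : (C e * g) %ₘ f' = C e * g := by
    rw [modByMonic_eq_self_iff hf']
    apply degree_lt_degree
    rw [natDegree_C_mul he]
    omega
  rw [h3] at h2
  have := congrArg (fun p => p.coeff m) h2
  simp only [coeff_C_mul] at this
  rw [show g.coeff m = 1 by rw [← hgm]; exact hg] at this
  exact ⟨_, by rw [mul_one] at this; exact this⟩

lemma build_inj_f {e : R} {J : Ideal R[X]} {f f' : R[X]} {m : ℕ}
    (hf : f.Monic) (hfm : f.natDegree = m + 1)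
    (hf' : f'.Monic) (hfm' : f'.natDegree = m + 1) (hfJ' : f' ∈ J)
    (h : build e J f = build e J f') : ∃ j ∈ J, degree j < ((m + 1 : ℕ) : WithBot ℕ) ∧ f - f' = C e * j := by
  have h1 : f - f' ∈ build e J f' := by
    refine Ideal.sub_mem _ ?_ ?_
    · rw [← h]; exact mem_build.2 ⟨0, J.zero_mem, 1, by simp⟩
    · exact mem_build.2 ⟨0, J.zero_mem, 1, by simp⟩
  obtain ⟨j, hj, hd, h2⟩ := (mem_build_iff hf' hfJ').1 h1
  refine ⟨j, hj, ?_, ?_⟩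
  · rw [← hfm', ← degree_eq_natDegree hf'.ne_zero]; exact hd
  rw [← h2, eq_comm, modByMonic_eq_self_iff hf']
  have := degree_sub_lt_left (p := f) (q := f') (by
    rw [degree_eq_natDegree hf.ne_zero, degree_eq_natDegree hf'.ne_zero, hfm, hfm']) hf.ne_zero
    (by rw [hf.leadingCoeff, hf'.leadingCoeff])
  rwa [degree_eq_natDegree hf.ne_zero, hfm, ← hfm', ← degree_eq_natDegree hf'.ne_zero] at this

variable [IsPrincipalIdealRing R]

lemma mem_lcNth {I : Ideal R[X]} {k : ℕ} {x : R} :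
    x ∈ I.leadingCoeffNth k ↔ ∃ p ∈ I, p.natDegree ≤ k ∧ p.coeff k = x := by
  unfold Ideal.leadingCoeffNth
  rw [Submodule.mem_map]
  constructor
  · rintro ⟨p, hp, rfl⟩
    exact ⟨p, hp.2, natDegree_le_iff_degree_le.2 (mem_degreeLE.1 hp.1), rfl⟩
  · rintro ⟨p, hp, hd, rfl⟩
    exact ⟨p, ⟨mem_degreeLE.2 (natDegree_le_iff_degree_le.1 hd), hp⟩, rfl⟩

lemma lc_dvd {I : Ideal R[X]} {c : R} (hc : c ≠ 0) (hcI : C c ∈ I) (k : ℕ) :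
    ∀ d : R, I.leadingCoeffNth k = Ideal.span {d} → ∀ p ∈ I, p.natDegree ≤ k → C d ∣ p := by
  induction k with
  | zero =>
    intro d hd p hp hk
    rw [eq_C_of_natDegree_le_zero hk] at hp ⊢
    have : p.coeff 0 ∈ I.leadingCoeffNth 0 := mem_lcNth.2 ⟨_, hp, by simp, by simp⟩
    rw [hd, Ideal.mem_span_singleton] at this
    exact _root_.map_dvd C this
  | succ k ih =>
    intro d hd p hp hk
    obtain ⟨d0, hd0⟩ := (IsPrincipalIdealRing.principal (I.leadingCoeffNth k)).principal
    change _ = Ideal.span _ at hd0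
    have hmem0 : d0 ∈ I.leadingCoeffNth k := by rw [hd0]; exact Ideal.mem_span_singleton_self _
    have hmem : d ∈ I.leadingCoeffNth (k + 1) := by rw [hd]; exact Ideal.mem_span_singleton_self _
    obtain ⟨p0, hp0, hp0d, hp0c⟩ := mem_lcNth.1 hmem0
    obtain ⟨g, hg, hgd, hgc⟩ := mem_lcNth.1 hmem
    have hd0ne : d0 ≠ 0 := by
      rintro rfl
      have : c ∈ I.leadingCoeffNth k := mem_lcNth.2 ⟨C c * X ^ k, I.mul_mem_right _ hcI,
        natDegree_C_mul_X_pow_le _ _, by simp⟩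
      rw [hd0, Ideal.mem_span_singleton, zero_dvd_iff] at this
      exact hc this
    have hdd : d ∣ d0 := by
      rw [← Ideal.mem_span_singleton, ← hd]
      refine mem_lcNth.2 ⟨p0 * X, I.mul_mem_right _ hp0, ?_, by simpa using hp0c⟩
      exact natDegree_mul_le.trans (by simpa using hp0d)
    obtain ⟨e, he⟩ := hdd
    have ene : e ≠ 0 := by rintro rfl; exact hd0ne (by simpa using he)
    have low : ∀ r ∈ I, r.natDegree ≤ k + 1 → r.coeff (k + 1) = 0 → C d0 ∣ r := by
      intro r hr hrd hrc
      refine ih d0 hd0 r hr ?_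
      by_contra hcon
      have h5 : r.natDegree = k + 1 := by omega
      rw [← h5] at hrc
      rw [coeff_natDegree, leadingCoeff_eq_zero] at hrc
      rw [hrc] at h5; simp at h5
    have h1 : C d0 ∣ p0 * X - C e * g := by
      refine low _ (I.sub_mem (I.mul_mem_right _ hp0) (I.mul_mem_left _ hg)) ?_ ?_
      · refine (natDegree_sub_le _ _).trans (max_le ?_ ?_)
        · exact natDegree_mul_le.trans (by simpa using hp0d)
        · exact (natDegree_C_mul_le _ _).trans hgd
      · simp [hp0c, hgc, he, mul_comm]
    have h2 : C d0 ∣ C e * g := by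
      have := dvd_sub ((ih d0 hd0 p0 hp0 hp0d).mul_right X) h1
      simpa using this
    have h3 : C d ∣ g := by
      rw [he, C_mul, mul_comm (C d)] at h2
      exact (mul_dvd_mul_iff_left (C_ne_zero.2 ene)).1 h2
    have h4 : p.coeff (k + 1) ∈ I.leadingCoeffNth (k + 1) := mem_lcNth.2 ⟨p, hp, hk, rfl⟩
    rw [hd, Ideal.mem_span_singleton] at h4
    obtain ⟨a, ha⟩ := h4
    have h5 : C d0 ∣ p - C a * g := by
      refine low _ (I.sub_mem hp (I.mul_mem_left _ hg)) ?_ ?_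
      · exact (natDegree_sub_le _ _).trans (max_le hk ((natDegree_C_mul_le _ _).trans hgd))
      · simp [hgc, ha, mul_comm]
    have h6 : C d ∣ p - C a * g := dvd_trans (by rw [he, C_mul]; exact dvd_mul_right _ _) h5
    have := dvd_add h6 (h3.mul_left (C a))
    simpa using this

/-- Structure theorem: decomposition of an ideal with a monic element of degree `m + 1`. -/
lemma exists_build {I : Ideal R[X]} {c : R} (hc : c ≠ 0) (hcI : C c ∈ I) {m : ℕ} {f : R[X]}
    (hf : f.Monic) (hfm : f.natDegree = m + 1) (hfI : f ∈ I) :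
    ∃ e : R, e ≠ 0 ∧ ∀ u : R, IsUnit u → ∃ J : Ideal R[X], I ≤ J ∧
      (∃ g ∈ J, g.Monic ∧ g.natDegree = m) ∧ I = build (e * u) J f := by
  obtain ⟨e, he⟩ := (IsPrincipalIdealRing.principal (I.leadingCoeffNth m)).principal
  change _ = Ideal.span _ at he
  have hene : e ≠ 0 := by
    rintro rfl
    have : c ∈ I.leadingCoeffNth m := mem_lcNth.2 ⟨C c * X ^ m, I.mul_mem_right _ hcI,
      natDegree_C_mul_X_pow_le _ _, by simp⟩
    rw [he, Ideal.mem_span_singleton, zero_dvd_iff] at this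
    exact hc this
  refine ⟨e, hene, fun u hu => ?_⟩
  have he' : I.leadingCoeffNth m = Ideal.span {e * u} := by
    rw [he]; exact (Ideal.span_singleton_mul_right_unit hu e).symm
  have hne : e * u ≠ 0 := mul_ne_zero hene hu.ne_zero
  generalize e * u = e at *
  have hdvd := lc_dvd hc hcI m e he'
  refine ⟨Submodule.comap (LinearMap.mulLeft R[X] (C e)) I, ?_, ?_, ?_⟩
  · intro p hp
    exact I.mul_mem_left _ hp
  · have hmem : e ∈ I.leadingCoeffNth m := by rw [he']; exact Ideal.mem_span_singleton_self _
    obtain ⟨g, hg, hgd, hgc⟩ := mem_lcNth.1 hmem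
    obtain ⟨g', rfl⟩ := hdvd g hg hgd
    rw [natDegree_C_mul hne] at hgd
    rw [coeff_C_mul] at hgc
    have h1 : g'.coeff m = 1 := mul_left_cancel₀ hne (by rw [hgc, mul_one])
    have h2 : g'.natDegree = m := le_antisymm hgd (le_natDegree_of_ne_zero (by rw [h1]; exact one_ne_zero))
    exact ⟨g', hg, by rw [Monic, leadingCoeff, h2, h1], h2⟩
  · apply le_antisymm
    · intro p hp
      have h1 := modByMonic_mem hfI hp
      obtain ⟨j, hj⟩ := hdvd _ h1 (by
        have := natDegree_modByMonic_lt p hf (by rintro rfl; simp at hfm)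
        omega)
      refine mem_build.2 ⟨j, ?_, p /ₘ f, by rw [← hj, modByMonic_add_div]⟩
      change C e * j ∈ I
      rw [← hj]; exact h1
    · intro p hp
      obtain ⟨j, hj, h, rfl⟩ := mem_build.1 hp
      exact I.add_mem hj (I.mul_mem_right _ hfI)

end Structure
end LaurentCount

namespace LaurentCount
open Polynomial

section Counting
variable {R : Type*} [CommRing R] 

/-- elements of `J` of degree `< k` -/
noncomputable def lowPart (J : Ideal R[X]) (k : ℕ) : Submodule R R[X] :=
  degreeLT R k ⊓ J.restrictScalars R

lemma mem_lowPart {J : Ideal R[X]} {k : ℕ} {p : R[X]} :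
    p ∈ lowPart J k ↔ p.degree < k ∧ p ∈ J := by
  simp [lowPart, mem_degreeLT]

/-- The submodule `e M` of `M = lowPart J k`. -/
noncomputable def smulLow (e : R) (J : Ideal R[X]) (k : ℕ) : Submodule R (lowPart J k) :=
  Ideal.span {e} • ⊤

lemma mem_smulLow {e : R} {J : Ideal R[X]} {k : ℕ} {p : lowPart J k} :
    p ∈ smulLow e J k ↔ ∃ j : lowPart J k, p.1 = C e * j.1 := by
  unfold smulLow
  rw [Submodule.ideal_span_singleton_smul, Submodule.mem_smul_pointwise_iff_exists]
  constructor
  · rintro ⟨b, -, rfl⟩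
    exact ⟨b, by simp [smul_eq_C_mul]⟩
  · rintro ⟨b, hb⟩
    exact ⟨b, trivial, Subtype.ext (by rw [hb]; simp [smul_eq_C_mul])⟩

lemma card_pi_quot (e : R) (k : ℕ) {M : Type*} [AddCommGroup M] [Module R M]
    (φ : M ≃ₗ[R] (Fin k → R)) :
    Nat.card (M ⧸ (Ideal.span {e} • ⊤ : Submodule R M)) = Nat.card (R ⧸ Ideal.span {e}) ^ k := by
  let ψ : M →ₗ[R] (Fin k → R ⧸ Ideal.span {e}) :=
    (LinearMap.pi fun i => (Submodule.mkQ (Ideal.span {e})).comp (LinearMap.proj i)).comp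
      φ.toLinearMap
  have hs : Function.Surjective ψ := by
    intro y
    choose x hx using fun i => Submodule.mkQ_surjective (Ideal.span {e}) (y i)
    refine ⟨φ.symm x, ?_⟩
    ext i
    simp [ψ, ← hx]
  have hk : LinearMap.ker ψ = Ideal.span {e} • ⊤ := by
    ext p
    rw [LinearMap.mem_ker, Submodule.ideal_span_singleton_smul,
      Submodule.mem_smul_pointwise_iff_exists]
    constructor
    · intro h
      have h1 : ∀ i, ∃ b, φ p i = e * b := by
        intro i
        have := congrFun h i
        simp only [ψ, LinearMap.comp_apply, LinearMap.pi_apply, LinearEquiv.coe_coe,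
          LinearMap.proj_apply, Pi.zero_apply] at this
        rw [Submodule.mkQ_apply, Submodule.Quotient.mk_eq_zero, Ideal.mem_span_singleton] at this
        exact this
      choose b hb using h1
      refine ⟨φ.symm b, trivial, ?_⟩
      apply φ.injective
      rw [map_smul, LinearEquiv.apply_symm_apply]
      ext i
      simp [hb]
    · rintro ⟨b, -, rfl⟩
      ext i
      simp only [ψ, LinearMap.comp_apply, LinearMap.pi_apply, LinearEquiv.coe_coe,
          LinearMap.proj_apply, Pi.zero_apply]
      rw [Submodule.mkQ_apply, Submodule.Quotient.mk_eq_zero, Ideal.mem_span_singleton]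
      simp
  rw [← hk, Nat.card_congr (ψ.quotKerEquivOfSurjective hs).toEquiv, Nat.card_fun]
  simp

variable [IsDomain R] [IsPrincipalIdealRing R]

lemma lowPart_equiv {J : Ideal R[X]} {c : R} (hc : c ≠ 0) (hcJ : C c ∈ J) (k : ℕ) :
    Nonempty (lowPart J k ≃ₗ[R] (Fin k → R)) := by
  let φ := degreeLTEquiv R k
  let ι : lowPart J k →ₗ[R] (Fin k → R) := φ.toLinearMap.comp
    (Submodule.inclusion (inf_le_left : lowPart J k ≤ degreeLT R k))
  have hι : Function.Injective ι := φ.injective.comp (Submodule.inclusion_injective _)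
  have : Module.Finite R (lowPart J k) := Module.Finite.of_injective ι hι
  have : Module.IsTorsionFree R (lowPart J k) := inferInstance
  have : Module.Free R (lowPart J k) := inferInstance
  let κ : (Fin k → R) →ₗ[R] lowPart J k :=
    (LinearMap.codRestrict (lowPart J k) ((LinearMap.lsmul R R[X] c).comp (degreeLT R k).subtype)
      (by
        intro p
        rw [mem_lowPart]
        simp only [LinearMap.comp_apply, Submodule.subtype_apply, LinearMap.lsmul_apply]
        refine ⟨(degree_smul_le _ _).trans_lt (mem_degreeLT.1 p.2), ?_⟩
        rw [smul_eq_C_mul]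
        exact J.mul_mem_right _ hcJ)).comp φ.symm.toLinearMap
  have hκ : Function.Injective κ := by
    rw [injective_iff_map_eq_zero]
    intro a ha
    have h1 : c • (φ.symm a).1 = 0 := congrArg Subtype.val ha
    have h2 := (smul_eq_zero.1 h1).resolve_left hc
    have h3 : φ.symm a = 0 := Subtype.ext h2
    simpa using h3
  have h1 := LinearMap.finrank_le_finrank_of_injective hι
  have h2 := LinearMap.finrank_le_finrank_of_injective hκ
  exact ⟨LinearEquiv.ofFinrankEq _ _ (le_antisymm h1 h2)⟩

lemma card_low {J : Ideal R[X]} {c : R} (hc : c ≠ 0) (hcJ : C c ∈ J) (k : ℕ) (e : R) :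
    Nat.card (lowPart J k ⧸ smulLow e J k) = Nat.card (R ⧸ Ideal.span {e}) ^ k :=
  card_pi_quot e k (lowPart_equiv hc hcJ k).some

lemma card_build {J : Ideal R[X]} {c : R} (hc : c ≠ 0) (hcJ : C c ∈ J) (k : ℕ) (e : R)
    {f : R[X]} (hf : f.Monic) (hfk : f.natDegree = k) (hfJ : f ∈ J) :
    Nat.card (R[X] ⧸ build e J f) =
      Nat.card (R[X] ⧸ J) * Nat.card (R ⧸ Ideal.span {e}) ^ k := by
  have hdf : f.degree = k := by rw [degree_eq_natDegree hf.ne_zero, hfk]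
  rw [← card_low hc hcJ k e]
  have hle : build e J f ≤ J := by
    intro p hp
    obtain ⟨j, hj, h, rfl⟩ := mem_build.1 hp
    exact J.add_mem (J.mul_mem_left _ hj) (J.mul_mem_right _ hfJ)
  have h1 := AddSubgroup.relIndex_mul_index
    (H := (build e J f).toAddSubgroup) (K := J.toAddSubgroup) hle
  have h2 : (build e J f).toAddSubgroup.relIndex J.toAddSubgroup =
      Nat.card (lowPart J k ⧸ smulLow e J k) := by
    let ψ : lowPart J k →+ J.toAddSubgroup ⧸
        ((build e J f).toAddSubgroup.addSubgroupOf J.toAddSubgroup) :=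
      (QuotientAddGroup.mk' _).comp
        ((lowPart J k).subtype.toAddMonoidHom.codRestrict J.toAddSubgroup
          (fun p => (mem_lowPart.1 p.2).2))
    have hψ : ∀ p, ψ p = 0 ↔ p ∈ (smulLow e J k).toAddSubgroup := by
      intro p
      have : ψ p = 0 ↔ p.1 ∈ build e J f := by
        change (QuotientAddGroup.mk _ : J.toAddSubgroup ⧸
          ((build e J f).toAddSubgroup.addSubgroupOf J.toAddSubgroup)) = 0 ↔ _
        rw [QuotientAddGroup.eq_zero_iff, AddSubgroup.mem_addSubgroupOf]
        rfl
      rw [this, mem_build_iff hf hfJ, (modByMonic_eq_self_iff hf).2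
        (by rw [hdf]; exact (mem_lowPart.1 p.2).1)]
      change _ ↔ p ∈ smulLow e J k
      rw [mem_smulLow]
      constructor
      · rintro ⟨j, hj, hd, h⟩
        exact ⟨⟨j, mem_lowPart.2 ⟨by rw [← hdf]; exact hd, hj⟩⟩, h⟩
      · rintro ⟨j, hj⟩
        exact ⟨j.1, (mem_lowPart.1 j.2).2, by rw [hdf]; exact (mem_lowPart.1 j.2).1, hj⟩
    have hk : ψ.ker = (smulLow e J k).toAddSubgroup := by
      ext p
      exact hψ p
    have hs : Function.Surjective ψ := by
      intro y
      obtain ⟨⟨p, hp⟩, rfl⟩ := QuotientAddGroup.mk_surjective y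
      refine ⟨⟨p %ₘ f, mem_lowPart.2 ⟨by rw [← hdf]; exact degree_modByMonic_lt _ hf,
        modByMonic_mem hfJ hp⟩⟩, ?_⟩
      change (QuotientAddGroup.mk _ : J.toAddSubgroup ⧸
          ((build e J f).toAddSubgroup.addSubgroupOf J.toAddSubgroup)) = QuotientAddGroup.mk _
      rw [QuotientAddGroup.eq, AddSubgroup.mem_addSubgroupOf]
      change -(p %ₘ f) + p ∈ build e J f
      refine mem_build.2 ⟨0, J.zero_mem, p /ₘ f, ?_⟩
      rw [modByMonic_eq_sub_mul_div]; ring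
    have := Nat.card_congr (QuotientAddGroup.quotientKerEquivOfSurjective ψ hs).toEquiv
    rw [hk] at this
    exact this.symm
  rw [h2] at h1
  rw [mul_comm]
  exact h1.symm

/-- constant coefficient on `lowPart` -/
noncomputable def evLow (J : Ideal R[X]) (k : ℕ) : lowPart J k →ₗ[R] R :=
  (lcoeff R 0).comp (lowPart J k).subtype

noncomputable def evBar (e : R) (J : Ideal R[X]) (k : ℕ) :
    (lowPart J k ⧸ smulLow e J k) →ₗ[R] (R ⧸ Ideal.span {e}) :=
  Submodule.mapQ _ _ (evLow J k) (by
    intro p hp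
    obtain ⟨j, hj⟩ := mem_smulLow.1 hp
    rw [Submodule.mem_comap, Ideal.mem_span_singleton]
    refine ⟨j.1.coeff 0, ?_⟩
    simp only [evLow, LinearMap.comp_apply, Submodule.subtype_apply, lcoeff_apply]
    rw [hj, coeff_C_mul])

lemma evBar_mk (e : R) (J : Ideal R[X]) (k : ℕ) (p : lowPart J k) :
    evBar e J k (Submodule.Quotient.mk p) = Ideal.Quotient.mk (Ideal.span {e}) (p.1.coeff 0) := rfl

lemma evBar_surj (e : R) {J : Ideal R[X]} {m : ℕ} {g : R[X]} (hg : g.Monic)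
    (hgm : g.natDegree = m) (hgJ : g ∈ J) (hX : ∃ r, 1 - X * r ∈ J) :
    Function.Surjective (evBar e J (m + 1)) := by
  intro y
  obtain ⟨a, rfl⟩ := Ideal.Quotient.mk_surjective y
  obtain ⟨r, hr⟩ := hX
  set p := C a * (1 - X * r) with hp
  have hpJ : p ∈ J := J.mul_mem_left _ hr
  have hp0 : p.coeff 0 = a := by simp [hp]
  let p' := p %ₘ g + C ((p /ₘ g).coeff 0) * g
  have hp' : p'.coeff 0 = a := by
    conv_rhs => rw [← hp0, ← modByMonic_add_div p g]
    simp [p', mul_comm]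
  have hpl : p' ∈ lowPart J (m + 1) := by
    rw [mem_lowPart]
    refine ⟨?_, J.add_mem (modByMonic_mem hgJ hpJ) (J.mul_mem_left _ hgJ)⟩
    refine (degree_add_le _ _).trans_lt (max_lt ?_ ?_)
    · refine (degree_modByMonic_lt _ hg).trans ?_
      rw [degree_eq_natDegree hg.ne_zero, hgm]
      exact_mod_cast Nat.lt_succ_self m
    · rw [← smul_eq_C_mul]
      refine (degree_smul_le _ _).trans_lt ?_
      rw [degree_eq_natDegree hg.ne_zero, hgm]
      exact_mod_cast Nat.lt_succ_self m
  refine ⟨Submodule.Quotient.mk ⟨p', hpl⟩, ?_⟩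
  rw [evBar_mk, hp']

lemma card_preimage {G H : Type*} [AddCommGroup G] [AddCommGroup H] (φ : G →+ H)
    (hφ : Function.Surjective φ) (P : H → Prop) :
    Nat.card {z : G // P (φ z)} * Nat.card H = Nat.card {u : H // P u} * Nat.card G := by
  choose s hs using hφ
  let E : G ≃ H × φ.ker :=
    { toFun := fun g => (φ g, ⟨g - s (φ g), by simp [AddMonoidHom.mem_ker, hs]⟩)
      invFun := fun x => s x.1 + x.2.1
      left_inv := fun g => by simp
      right_inv := fun x => by
        have h : φ x.2.1 = 0 := x.2.2
        ext <;> simp [hs, h] }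
  let E' : {z : G // P (φ z)} ≃ {u : H // P u} × φ.ker :=
    { toFun := fun g => (⟨φ g.1, g.2⟩, ⟨g.1 - s (φ g.1), by simp [AddMonoidHom.mem_ker, hs]⟩)
      invFun := fun x => ⟨s x.1.1 + x.2.1, by
        have h : φ x.2.1 = 0 := x.2.2
        simpa [hs, h] using x.1.2⟩
      left_inv := fun g => by simp
      right_inv := fun x => by
        have h : φ x.2.1 = 0 := x.2.2
        ext <;> simp [hs, h] }
  rw [Nat.card_congr E, Nat.card_congr E', Nat.card_prod, Nat.card_prod]
  ring

lemma card_units_low {J : Ideal R[X]} {c : R} (hc : c ≠ 0) (hcJ : C c ∈ J) (e : R) {m : ℕ}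
    {g : R[X]} (hg : g.Monic)
    (hgm : g.natDegree = m) (hgJ : g ∈ J) (hX : ∃ r, 1 - X * r ∈ J)
    (he : Nat.card (R ⧸ Ideal.span {e}) ≠ 0) :
    Nat.card {z : lowPart J (m + 1) ⧸ smulLow e J (m + 1) // IsUnit (evBar e J (m + 1) z)} =
      Nat.card {u : R ⧸ Ideal.span {e} // IsUnit u} * Nat.card (R ⧸ Ideal.span {e}) ^ m := by
  have := card_preimage (evBar e J (m + 1)).toAddMonoidHom (evBar_surj e hg hgm hgJ hX)
    (fun u => IsUnit u)
  rw [card_low hc hcJ, pow_succ, ← mul_assoc] at this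
  exact Nat.eq_of_mul_eq_mul_right (Nat.pos_of_ne_zero he) this

end Counting
end LaurentCount

namespace LaurentCount
open Polynomial

section Recursion
variable (F : Type*) [Field F]

/-- monic polynomials of degree `d` with nonzero constant coefficient -/
def MonSet (d : ℕ) : Set F[X] := {e | e.Monic ∧ e.natDegree = d ∧ e.coeff 0 ≠ 0}

variable {F} in
/-- `x` and `y` are invertible modulo `I` -/
def Good (I : Ideal F[X][X]) : Prop :=
  (∃ r, 1 - X * r ∈ I) ∧ (∃ r, 1 - C X * r ∈ I)

def XSet (m n : ℕ) : Set (Ideal F[X][X]) :=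
  {I | (∃ f ∈ I, f.Monic ∧ f.natDegree = m) ∧ Good I ∧
    Nat.card (F[X][X] ⧸ I) = Nat.card F ^ n}

/-- total number of pairs (monic e of degree d not divisible by x, unit mod e) -/
noncomputable def Ecount (d : ℕ) : ℕ :=
  Nat.card (Σ e : MonSet F d, {u : F[X] ⧸ Ideal.span {e.1} // IsUnit u})

variable {F}

lemma Good.mono {I J : Ideal F[X][X]} (h : Good I) (hIJ : I ≤ J) : Good J :=
  ⟨h.1.imp fun _ hr => hIJ hr, h.2.imp fun _ hr => hIJ hr⟩

lemma isUnit_mk_iff {R : Type*} [CommRing R] {e a : R} :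
    IsUnit (Ideal.Quotient.mk (Ideal.span {e}) a) ↔ ∃ b c, a * b + e * c = 1 := by
  constructor
  · intro h
    obtain ⟨y, hy⟩ := h.exists_right_inv
    obtain ⟨b, rfl⟩ := Ideal.Quotient.mk_surjective y
    rw [← map_mul, ← map_one (Ideal.Quotient.mk (Ideal.span {e})), Ideal.Quotient.eq,
      Ideal.mem_span_singleton] at hy
    obtain ⟨c, hc⟩ := hy
    exact ⟨b, -c, by linear_combination hc⟩
  · rintro ⟨b, c, h⟩
    refine IsUnit.of_mul_eq_one (Ideal.Quotient.mk _ b) ?_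
    rw [← map_mul, ← map_one (Ideal.Quotient.mk (Ideal.span {e})), Ideal.Quotient.eq,
      Ideal.mem_span_singleton]
    exact ⟨-c, by linear_combination h⟩

lemma good_build {e : F[X]} {J : Ideal F[X][X]} {f : F[X][X]} (hJ : Good J)
    (he : e.coeff 0 ≠ 0) (hu : IsUnit (Ideal.Quotient.mk (Ideal.span {e}) (f.coeff 0))) :
    Good (build e J f) := by
  obtain ⟨⟨r, hr⟩, ⟨r', hr'⟩⟩ := hJ
  constructor
  · obtain ⟨b, c, h⟩ := isUnit_mk_iff.1 hu
    set p := C e * (C c * (1 - X * r)) + f * C b with hp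
    have h0 : (1 - p).coeff 0 = 0 := by
      simp [hp]
      linear_combination -h
    obtain ⟨s, hs⟩ := X_dvd_iff.2 h0
    refine ⟨s, mem_build.2 ⟨_, J.mul_mem_left (C c) hr, C b, ?_⟩⟩
    rw [← hp]
    linear_combination hs
  · have h0 : (1 - e * C (e.coeff 0)⁻¹).coeff 0 = 0 := by simp [he]
    obtain ⟨s, hs⟩ := X_dvd_iff.2 h0
    have hs' : C e * C (C (e.coeff 0)⁻¹) = (1 - C X * C s : F[X][X]) := by
      rw [← C_mul, ← C_mul, ← C_1, ← C_sub]
      congr 1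
      linear_combination -hs
    refine ⟨C s + r' - C X * C s * r', mem_build.2
      ⟨_, J.mul_mem_left (C (C (e.coeff 0)⁻¹)) hr', 0, ?_⟩⟩
    linear_combination -(1 - C X * r') * hs'

lemma of_good_build {e : F[X]} {J : Ideal F[X][X]} {f : F[X][X]} {m : ℕ} (hf : f.Monic)
    (hfm : f.natDegree = m + 1) (h : Good (build e J f)) :
    e.coeff 0 ≠ 0 ∧ IsUnit (Ideal.Quotient.mk (Ideal.span {e}) (f.coeff 0)) := by
  obtain ⟨⟨r, hr⟩, ⟨r', hr'⟩⟩ := h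
  constructor
  · intro he
    obtain ⟨j, hj, k, hk⟩ := mem_build.1 hr'
    have h1 := congrArg (Polynomial.map (constantCoeff (R := F))) hk
    simp [he] at h1
    have h2 := natDegree_eq_zero_of_isUnit (IsUnit.of_mul_eq_one _ h1.symm)
    rw [hf.natDegree_map] at h2
    omega
  · obtain ⟨j, hj, k, hk⟩ := mem_build.1 hr
    have h1 := congrArg (fun p => p.coeff 0) hk
    simp at h1
    exact isUnit_mk_iff.2 ⟨k.coeff 0, j.coeff 0, by linear_combination -h1⟩

lemma monic_lift {J : Ideal F[X][X]} {m : ℕ} {g p : F[X][X]} (hg : g.Monic)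
    (hgm : g.natDegree = m) (hgJ : g ∈ J) (hp : p ∈ lowPart J (m + 1)) :
    (X * g + p).Monic ∧ (X * g + p).natDegree = m + 1 ∧ X * g + p ∈ J ∧
      (X * g + p).coeff 0 = p.coeff 0 := by
  rw [mem_lowPart] at hp
  have h1 : (X * g).Monic := monic_X.mul hg
  have h2 : (X * g).natDegree = m + 1 := by
    rw [monic_X.natDegree_mul hg, hgm, natDegree_X, add_comm]
  have h3 : p.degree < (X * g).degree := by
    rw [degree_eq_natDegree h1.ne_zero, h2]; exact hp.1
  refine ⟨h1.add_of_left h3, ?_, J.add_mem (J.mul_mem_left _ hgJ) hp.2, by simp⟩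
  rw [natDegree_add_eq_left_of_degree_lt h3, h2]

variable [Finite F]

lemma card_quot_monic {e : F[X]} (he : e.Monic) :
    Nat.card (F[X] ⧸ Ideal.span {e}) = Nat.card F ^ e.natDegree := by
  have : Module.Finite F (F[X] ⧸ Ideal.span {e}) := he.finite_quotient
  rw [Module.natCard_eq_pow_finrank (K := F), finrank_quotient_span_eq_natDegree]

lemma exists_const {I : Ideal F[X][X]} {n : ℕ}
    (h : Nat.card (F[X][X] ⧸ I) = Nat.card F ^ n) : ∃ c : F[X], c ≠ 0 ∧ C c ∈ I := by
  have : Finite (F[X][X] ⧸ I) := Nat.finite_of_card_ne_zero (by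
    rw [h]; exact pow_ne_zero _ Nat.card_pos.ne')
  obtain ⟨a, b, hab, h⟩ := Finite.exists_ne_map_eq_of_infinite
    (fun a : F[X] => Ideal.Quotient.mk I (C a))
  refine ⟨a - b, sub_ne_zero.2 hab, ?_⟩
  rw [C_sub]
  exact Ideal.Quotient.eq.1 h

lemma card_quot_eq_pow {J : Ideal F[X][X]} (h : Nat.card (F[X][X] ⧸ J) ≠ 0) :
    ∃ a, Nat.card (F[X][X] ⧸ J) = Nat.card F ^ a := by
  have : Finite (F[X][X] ⧸ J) := Nat.finite_of_card_ne_zero h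
  exact ⟨_, Module.natCard_eq_pow_finrank (K := F)⟩

lemma one_lt_q : 1 < Nat.card F := Finite.one_lt_card

/-- the chosen monic generator of top degree -/
noncomputable def gOf {m n : ℕ} (J : XSet F m n) : F[X][X] := J.2.1.choose

lemma gOf_spec {m n : ℕ} (J : XSet F m n) :
    gOf J ∈ J.1 ∧ (gOf J).Monic ∧ (gOf J).natDegree = m := J.2.1.choose_spec

/-- parameters for ideals of level `m + 1` -/
abbrev Param (F : Type*) [Field F] (m n : ℕ) (d : ℕ) : Type _ :=
  Σ e : MonSet F d, Σ J : XSet F m (n - (m + 1) * d),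
    {z : lowPart J.1 (m + 1) ⧸ smulLow e.1 J.1 (m + 1) // IsUnit (evBar e.1 J.1 (m + 1) z)}

noncomputable def fOf {m n' : ℕ} {e : F[X]} (J : XSet F m n')
    (z : lowPart J.1 (m + 1) ⧸ smulLow e J.1 (m + 1)) : F[X][X] :=
  X * gOf J + (Quotient.out z : lowPart J.1 (m + 1)).1

lemma fOf_spec {m n' : ℕ} {e : F[X]} (J : XSet F m n')
    (z : lowPart J.1 (m + 1) ⧸ smulLow e J.1 (m + 1)) :
    (fOf J z).Monic ∧ (fOf J z).natDegree = m + 1 ∧ fOf J z ∈ J.1 ∧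
      Ideal.Quotient.mk (Ideal.span {e}) ((fOf J z).coeff 0) = evBar e J.1 (m + 1) z := by
  have hz : Submodule.Quotient.mk (Quotient.out z) = z := Quotient.out_eq z
  obtain ⟨h1, h2, h3⟩ := gOf_spec J
  obtain ⟨a, b, c, d⟩ := monic_lift h2 h3 h1 (Quotient.out z : lowPart J.1 (m + 1)).2
  refine ⟨a, b, c, ?_⟩
  unfold fOf
  rw [d, ← evBar_mk, hz]

lemma build_mem_XSet {m n d : ℕ} (hd : (m + 1) * d ≤ n) {e : F[X]} (he : e ∈ MonSet F d)
    (J : XSet F m (n - (m + 1) * d)) {f : F[X][X]} (hf : f.Monic) (hfm : f.natDegree = m + 1)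
    (hfJ : f ∈ J.1) (hu : IsUnit (Ideal.Quotient.mk (Ideal.span {e}) (f.coeff 0))) :
    build e J.1 f ∈ XSet F (m + 1) n := by
  obtain ⟨c, hc, hcJ⟩ := exists_const J.2.2.2
  refine ⟨⟨f, mem_build.2 ⟨0, Ideal.zero_mem _, 1, by simp⟩, hf, hfm⟩,
    good_build J.2.2.1 he.2.2 hu, ?_⟩
  rw [card_build hc hcJ (m + 1) e hf hfm hfJ, J.2.2.2, card_quot_monic he.1, he.2.1, ← pow_mul,
    ← pow_add]
  congr 1
  rw [mul_comm d]
  omega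

noncomputable def paramMap (m n : ℕ) (x : Σ d : {d // d ∈ (Finset.range (n + 1)).filter
    (fun d => (m + 1) * d ≤ n)}, Param F m n d.1) : XSet F (m + 1) n :=
  ⟨build x.2.1.1 x.2.2.1.1 (fOf x.2.2.1 x.2.2.2.1),
    build_mem_XSet (Finset.mem_filter.1 x.1.2).2 x.2.1.2 x.2.2.1 (fOf_spec _ _).1
      (fOf_spec _ _).2.1 (fOf_spec _ _).2.2.1 (by rw [(fOf_spec _ _).2.2.2]; exact x.2.2.2.2)⟩

lemma paramMap_injective (m n : ℕ) : Function.Injective (paramMap (F := F) m n) := by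
  rintro ⟨⟨d, hd⟩, ⟨e, he⟩, ⟨J, hJ⟩, ⟨z, hz⟩⟩ ⟨⟨d', hd'⟩, ⟨e', he'⟩, ⟨J', hJ'⟩, ⟨z', hz'⟩⟩ h
  have h := congrArg Subtype.val h
  simp only [paramMap] at h
  obtain ⟨g1, g2, g3⟩ := gOf_spec ⟨J, hJ⟩
  obtain ⟨g1', g2', g3'⟩ := gOf_spec ⟨J', hJ'⟩
  obtain ⟨f1, f2, f3, f4⟩ := fOf_spec ⟨J, hJ⟩ z
  obtain ⟨f1', f2', f3', f4'⟩ := fOf_spec ⟨J', hJ'⟩ z'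
  have hee : e = e' := by
    apply eq_of_monic_of_associated he.1 he'.1
    apply associated_of_dvd_dvd
    · exact dvd_of_build_le he'.1.ne_zero g2' g3' g1' f1 f2 f3 h.ge
    · exact dvd_of_build_le he.1.ne_zero g2 g3 g1 f1' f2' f3' h.le
  subst hee
  have hdd : d = d' := he.2.1.symm.trans he'.2.1
  subst hdd
  have hJJ : J = J' := by
    ext p
    rw [← mem_of_C_mul_mem_build he.1.ne_zero f1 f3, h,
      mem_of_C_mul_mem_build he.1.ne_zero f1' f3']
  subst hJJ
  obtain ⟨j, hj, hjd, hjf⟩ := build_inj_f f1 f2 f1' f2' f3' h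
  have hzz : z = z' := by
    have e1 : Submodule.Quotient.mk (Quotient.out z) = z := Quotient.out_eq z
    have e2 : Submodule.Quotient.mk (Quotient.out z') = z' := Quotient.out_eq z'
    rw [← e1, ← e2, Submodule.Quotient.eq, mem_smulLow]
    refine ⟨⟨j, mem_lowPart.2 ⟨hjd, hj⟩⟩, ?_⟩
    rw [← hjf]
    simp [fOf]
  subst hzz
  rfl

lemma paramMap_surjective (m n : ℕ) : Function.Surjective (paramMap (F := F) m n) := by
  rintro ⟨I, ⟨f, hfI, hf, hfm⟩, hgood, hcard⟩
  obtain ⟨c, hc, hcI⟩ := exists_const hcard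
  obtain ⟨e0, he0, H⟩ := exists_build hc hcI hf hfm hfI
  have hu : IsUnit (C (e0.leadingCoeff)⁻¹) :=
    isUnit_C.2 (isUnit_iff_ne_zero.2 (inv_ne_zero (leadingCoeff_ne_zero.2 he0)))
  obtain ⟨J, hIJ, ⟨g, hgJ, hg, hgm⟩, hI⟩ := H _ hu
  have hem : (e0 * C (e0.leadingCoeff)⁻¹).Monic := monic_mul_leadingCoeff_inv he0
  generalize e0 * C (e0.leadingCoeff)⁻¹ = e at *
  have hgood' := hgood
  rw [hI] at hgood'
  obtain ⟨h0, hunit⟩ := of_good_build hf hfm hgood'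
  have hcd := hcard
  rw [hI, card_build hc (hIJ hcI) (m + 1) e hf hfm (hIJ hfI), card_quot_monic hem] at hcd
  obtain ⟨a, ha⟩ := card_quot_eq_pow (J := J) (by
    intro h0; rw [h0, zero_mul] at hcd
    exact pow_ne_zero n (Nat.card_pos (α := F)).ne' hcd.symm)
  rw [ha, ← pow_mul, ← pow_add] at hcd
  have hn := Nat.pow_right_injective (one_lt_q (F := F)) hcd
  have hle : (m + 1) * e.natDegree ≤ n := by rw [mul_comm]; omega
  have hJ : J ∈ XSet F m (n - (m + 1) * e.natDegree) := by
    refine ⟨⟨g, hgJ, hg, hgm⟩, hgood.mono hIJ, ?_⟩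
    rw [ha]; congr 1; rw [mul_comm (m + 1)]; omega
  have hd : e.natDegree ∈ (Finset.range (n + 1)).filter (fun d => (m + 1) * d ≤ n) := by
    rw [Finset.mem_filter, Finset.mem_range]
    exact ⟨by nlinarith, hle⟩
  obtain ⟨q1, q2, q3⟩ := gOf_spec ⟨J, hJ⟩
  have hXg := monic_lift q2 q3 q1 (Submodule.zero_mem (lowPart J (m + 1)))
  rw [add_zero] at hXg
  have hlow : f - X * gOf ⟨J, hJ⟩ ∈ lowPart J (m + 1) := by
    rw [mem_lowPart]
    refine ⟨?_, J.sub_mem (hIJ hfI) (J.mul_mem_left _ q1)⟩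
    have hdf : f.degree = ((m + 1 : ℕ) : WithBot ℕ) := by
      rw [degree_eq_natDegree hf.ne_zero, hfm]
    rw [← hdf]
    refine degree_sub_lt_left ?_ hf.ne_zero ?_
    · rw [hdf, degree_eq_natDegree hXg.1.ne_zero, hXg.2.1]
    · rw [hf.leadingCoeff, hXg.1.leadingCoeff]
  let z : lowPart J (m + 1) ⧸ smulLow e J (m + 1) := Submodule.Quotient.mk ⟨_, hlow⟩
  have hz : IsUnit (evBar e J (m + 1) z) := by
    rw [evBar_mk]
    simpa using hunit
  refine ⟨⟨⟨_, hd⟩, ⟨e, hem, rfl, h0⟩, ⟨J, hJ⟩, ⟨z, hz⟩⟩, Subtype.ext ?_⟩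
  simp only [paramMap]
  rw [hI]
  have e1 : Submodule.Quotient.mk (Quotient.out z) = z := Quotient.out_eq z
  rw [Submodule.Quotient.eq, mem_smulLow] at e1
  obtain ⟨j, hj⟩ := e1
  refine build_congr (mem_lowPart.1 j.2).2 ?_ (j := j.1)
  rw [← hj]
  simp [fOf]
  ring

lemma finite_MonSet (d : ℕ) : Finite (MonSet F d) := by
  have : Finite (degreeLT F d) := Finite.of_equiv _ (degreeLTEquiv F d).toEquiv.symm
  have : Finite {p : F[X] // p.Monic ∧ p.natDegree = d} := Finite.of_equiv _
    (monicEquivDegreeLT d).symm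
  exact Finite.of_injective
    (fun e : MonSet F d => (⟨e.1, e.2.1, e.2.2.1⟩ : {p : F[X] // p.Monic ∧ p.natDegree = d}))
    (fun a b h => Subtype.ext (congrArg (fun x => x.1) h))

lemma card_Param (m n d : ℕ) (hfin : ∀ n, Finite (XSet F m n)) :
    Finite (Param F m n d) ∧ Nat.card (Param F m n d) =
      Ecount F d * Nat.card F ^ (m * d) * Nat.card (XSet F m (n - (m + 1) * d)) := by
  have hq : ∀ e : MonSet F d, Nat.card (F[X] ⧸ Ideal.span {e.1}) = Nat.card F ^ d := fun e => by
    rw [card_quot_monic e.2.1, e.2.2.1]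
  have hq0 : ∀ e : MonSet F d, Nat.card (F[X] ⧸ Ideal.span {e.1}) ≠ 0 := fun e => by
    rw [hq]; exact pow_ne_zero _ Nat.card_pos.ne'
  have i0 : ∀ e : MonSet F d, Finite (F[X] ⧸ Ideal.span {e.1}) := fun e =>
    Nat.finite_of_card_ne_zero (hq0 e)
  have i1 := finite_MonSet (F := F) d
  have i2 := hfin (n - (m + 1) * d)
  have i3 : ∀ (e : MonSet F d) (J : XSet F m (n - (m + 1) * d)),
      Finite (lowPart J.1 (m + 1) ⧸ smulLow e.1 J.1 (m + 1)) := fun e J => by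
    obtain ⟨c, hc, hcJ⟩ := exists_const J.2.2.2
    refine Nat.finite_of_card_ne_zero ?_
    rw [card_low hc hcJ]
    exact pow_ne_zero _ (hq0 e)
  refine ⟨inferInstance, ?_⟩
  have := Fintype.ofFinite (MonSet F d)
  have := Fintype.ofFinite (XSet F m (n - (m + 1) * d))
  rw [Nat.card_sigma]
  have key : ∀ e : MonSet F d, Nat.card (Σ J : XSet F m (n - (m + 1) * d),
    {z : lowPart J.1 (m + 1) ⧸ smulLow e.1 J.1 (m + 1) // IsUnit (evBar e.1 J.1 (m + 1) z)}) =
      Nat.card {u : F[X] ⧸ Ideal.span {e.1} // IsUnit u} *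
        (Nat.card F ^ (m * d) * Nat.card (XSet F m (n - (m + 1) * d))) := by
    intro e
    rw [Nat.card_sigma]
    have : ∀ J : XSet F m (n - (m + 1) * d), Nat.card {z : lowPart J.1 (m + 1) ⧸
        smulLow e.1 J.1 (m + 1) // IsUnit (evBar e.1 J.1 (m + 1) z)} =
        Nat.card {u : F[X] ⧸ Ideal.span {e.1} // IsUnit u} * Nat.card F ^ (m * d) := by
      intro J
      obtain ⟨c, hc, hcJ⟩ := exists_const J.2.2.2
      obtain ⟨g, hg, hg1, hg2⟩ := J.2.1
      rw [card_units_low hc hcJ e.1 hg1 hg2 hg J.2.2.1.1 (hq0 e), hq, ← pow_mul, mul_comm d m]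
    rw [Finset.sum_congr rfl fun J _ => this J, Finset.sum_const, Finset.card_univ,
      Nat.card_eq_fintype_card (α := XSet F m (n - (m + 1) * d)), smul_eq_mul]
    ring
  rw [Finset.sum_congr rfl fun e _ => key e, ← Finset.sum_mul, Ecount, Nat.card_sigma, mul_assoc]

theorem XSet_succ (m : ℕ) (hfin : ∀ n, Finite (XSet F m n)) (n : ℕ) :
    Finite (XSet F (m + 1) n) ∧ Nat.card (XSet F (m + 1) n) =
      ∑ d ∈ (Finset.range (n + 1)).filter (fun d => (m + 1) * d ≤ n),
        Ecount F d * Nat.card F ^ (m * d) * Nat.card (XSet F m (n - (m + 1) * d)) := by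
  have E := Equiv.ofBijective _ ⟨paramMap_injective (F := F) m n, paramMap_surjective m n⟩
  have : ∀ d, Finite (Param F m n d) := fun d => (card_Param m n d hfin).1
  refine ⟨Finite.of_equiv _ E, ?_⟩
  rw [← Nat.card_congr E, Nat.card_sigma]
  refine (Finset.sum_congr rfl fun d _ => (card_Param m n d.1 hfin).2).trans ?_
  exact Finset.sum_coe_sort ((Finset.range (n + 1)).filter (fun d => (m + 1) * d ≤ n))
    (fun d => Ecount F d * Nat.card F ^ (m * d) * Nat.card (XSet F m (n - (m + 1) * d)))

theorem XSet_zero (n : ℕ) : Finite (XSet F 0 n) ∧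
    Nat.card (XSet F 0 n) = if n = 0 then 1 else 0 := by
  have h : XSet F 0 n = if n = 0 then {⊤} else ∅ := by
    ext I
    constructor
    · rintro ⟨⟨f, hfI, hf, hf0⟩, hg, hc⟩
      have hI : I = ⊤ := by
        rw [Ideal.eq_top_iff_one]
        rwa [hf.natDegree_eq_zero.1 hf0] at hfI
      subst hI
      have h1 : Nat.card (F[X][X] ⧸ (⊤ : Ideal F[X][X])) = 1 := by
        have : Subsingleton (F[X][X] ⧸ (⊤ : Ideal F[X][X])) :=
          Ideal.Quotient.subsingleton_iff.2 rfl
        exact Nat.card_of_subsingleton 0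
      rw [h1] at hc
      have : n = 0 := Nat.pow_right_injective (one_lt_q (F := F)) (by simpa using hc.symm)
      simp [this]
    · split_ifs with hn
      · rintro rfl
        refine ⟨⟨1, trivial, monic_one, natDegree_one⟩, ⟨⟨0, trivial⟩, ⟨0, trivial⟩⟩, ?_⟩
        have : Subsingleton (F[X][X] ⧸ (⊤ : Ideal F[X][X])) :=
          Ideal.Quotient.subsingleton_iff.2 rfl
        rw [hn, Nat.card_of_subsingleton 0, pow_zero]
      · rintro ⟨⟩
  rw [h]
  split_ifs
  · exact ⟨Set.finite_singleton _, by simp⟩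
  · exact ⟨Set.finite_empty, by simp⟩

theorem finite_XSet (m : ℕ) : ∀ n, Finite (XSet F m n) := by
  induction m with
  | zero => exact fun n => (XSet_zero n).1
  | succ m ih => exact fun n => (XSet_succ m ih n).1

end Recursion
end LaurentCount

namespace LaurentCount
open Polynomial

section Ecount
variable (F : Type*) [Field F]

/-- pairs (e,h), deg h < deg e = d -/
def PairSet (d : ℕ) : Set (F[X] × F[X]) := {p | p.1 ∈ MonSet F d ∧ p.2.degree < d}

/-- coprime pairs (e,h), deg h < deg e = d -/
def CopSet (d : ℕ) : Set (F[X] × F[X]) :=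
  {p | p.1 ∈ MonSet F d ∧ p.2.degree < d ∧ IsCoprime p.1 p.2}

variable {F}

lemma monSet_degree {d : ℕ} {e : F[X]} (h : e ∈ MonSet F d) : e.degree = d := by
  rw [degree_eq_natDegree h.1.ne_zero, h.2.1]

noncomputable def copEquiv (d : ℕ) :
    (Σ e : MonSet F d, {u : F[X] ⧸ Ideal.span {e.1} // IsUnit u}) ≃ CopSet F d := by
  refine (Equiv.ofBijective (fun p : CopSet F d =>
    (⟨⟨p.1.1, p.2.1⟩, ⟨Ideal.Quotient.mk _ p.1.2, ?_⟩⟩ :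
      Σ e : MonSet F d, {u : F[X] ⧸ Ideal.span {e.1} // IsUnit u})) ⟨?_, ?_⟩).symm
  · obtain ⟨a, b, h⟩ := p.2.2.2
    exact isUnit_mk_iff.2 ⟨b, a, by linear_combination h⟩
  · rintro ⟨⟨e, h⟩, he, hd, hc⟩ ⟨⟨e', h'⟩, he', hd', hc'⟩ H
    dsimp only at he he' hd hd'
    obtain ⟨H1, H2⟩ := Sigma.mk.inj_iff.1 H
    have H3 : e = e' := congrArg Subtype.val H1
    subst H3
    have H4 := congrArg Subtype.val (eq_of_heq H2)
    dsimp only at H4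
    rw [Ideal.Quotient.eq, Ideal.mem_span_singleton] at H4
    have := eq_zero_of_dvd_of_degree_lt H4 (by
      rw [monSet_degree he]
      exact lt_of_le_of_lt (degree_sub_le _ _) (max_lt hd hd'))
    have h5 : h = h' := sub_eq_zero.1 this
    subst h5
    rfl
  · rintro ⟨⟨e, he⟩, ⟨u, hu⟩⟩
    obtain ⟨a, rfl⟩ := Ideal.Quotient.mk_surjective u
    have hm : Ideal.Quotient.mk (Ideal.span {e}) (a %ₘ e) = Ideal.Quotient.mk (Ideal.span {e}) a := by
      rw [Ideal.Quotient.eq, Ideal.mem_span_singleton]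
      exact ⟨-(a /ₘ e), by linear_combination modByMonic_add_div a e⟩
    have hu' := hu
    dsimp only at hu'
    rw [← hm] at hu'
    obtain ⟨b, c, h⟩ := isUnit_mk_iff.1 hu'
    refine ⟨⟨⟨e, a %ₘ e⟩, he, ?_, c, b, by linear_combination h⟩, ?_⟩
    · rw [← monSet_degree he]
      exact degree_modByMonic_lt _ he.1
    · exact Sigma.ext rfl (heq_of_eq (Subtype.ext hm))

lemma card_CopSet (d : ℕ) : Nat.card (CopSet F d) = Ecount F d :=
  (Nat.card_congr (copEquiv d)).symm

lemma card_degreeLT (d : ℕ) : Nat.card (degreeLT F d) = Nat.card F ^ d := by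
  rw [Nat.card_congr (degreeLTEquiv F d).toEquiv]
  simp [Nat.card_pi]

lemma card_PairSet (d : ℕ) : Nat.card (PairSet F d) = Nat.card (MonSet F d) * Nat.card F ^ d := by
  rw [← card_degreeLT, ← Nat.card_prod]
  exact Nat.card_congr
    { toFun := fun p => ⟨⟨p.1.1, p.2.1⟩, ⟨p.1.2, mem_degreeLT.2 p.2.2⟩⟩
      invFun := fun p => ⟨⟨p.1.1, p.2.1⟩, p.1.2, mem_degreeLT.1 p.2.2⟩
      left_inv := fun p => rfl
      right_inv := fun p => rfl }

lemma mul_mem_MonSet {i j d : ℕ} {a b : F[X]} (hij : i + j = d) (ha : a ∈ MonSet F i)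
    (hb : b ∈ MonSet F j) : a * b ∈ MonSet F d :=
  ⟨ha.1.mul hb.1, by rw [ha.1.natDegree_mul hb.1, ha.2.1, hb.2.1, hij], by
    rw [mul_coeff_zero]; exact mul_ne_zero ha.2.2 hb.2.2⟩

noncomputable def pairMap (d : ℕ) (x : Σ i : Fin (d + 1), MonSet F i × CopSet F (d - i)) : PairSet F d :=
  ⟨(x.2.1.1 * x.2.2.1.1, x.2.1.1 * x.2.2.1.2), by
    obtain ⟨i, ⟨g, hg⟩, ⟨⟨e, h⟩, he, hd, hc⟩⟩ := x
    have hi : (i : ℕ) + (d - i) = d := by have := i.2; omega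
    refine ⟨mul_mem_MonSet hi hg he, ?_⟩
    dsimp only at *
    rw [degree_mul, monSet_degree hg]
    calc ((i : ℕ) : WithBot ℕ) + h.degree < ((i : ℕ) : WithBot ℕ) + ((d - i : ℕ) : WithBot ℕ) :=
          WithBot.add_lt_add_left (by simp) hd
      _ = d := by exact_mod_cast hi⟩

lemma pairMap_injective (d : ℕ) : Function.Injective (pairMap (F := F) d) := by
  rintro ⟨i, ⟨g, hg⟩, ⟨⟨e, h⟩, he, hd, hc⟩⟩ ⟨i', ⟨g', hg'⟩, ⟨⟨e', h'⟩, he', hd', hc'⟩⟩ H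
  have H := congrArg Subtype.val H
  simp only [pairMap, Prod.mk.injEq] at H
  obtain ⟨H1, H2⟩ := H
  have key : g = g' := by
    obtain ⟨a, b, hab⟩ := hc
    obtain ⟨a', b', hab'⟩ := hc'
    dsimp only at hab hab'
    refine eq_of_monic_of_associated hg.1 hg'.1 (associated_of_dvd_dvd ?_ ?_)
    · exact ⟨a' * e + b' * h, by linear_combination -g' * hab' - a' * H1 - b' * H2⟩
    · exact ⟨a * e' + b * h', by linear_combination -g * hab + a * H1 + b * H2⟩
  subst key
  have hi : i = i' := Fin.ext (by rw [← hg.2.1, ← hg'.2.1])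
  subst hi
  have h1 := mul_left_cancel₀ hg.1.ne_zero H1
  have h2 := mul_left_cancel₀ hg.1.ne_zero H2
  subst h1 h2
  rfl

lemma pairMap_surjective (d : ℕ) : Function.Surjective (pairMap (F := F) d) := by
  rintro ⟨⟨e, h⟩, he, hd⟩
  dsimp only at he hd
  classical
  obtain ⟨g0, hg0, hge, hgh, a, b, hab⟩ : ∃ g : F[X], g ≠ 0 ∧ g ∣ e ∧ g ∣ h ∧
      ∃ a b, a * e + b * h = g := by
    refine ⟨EuclideanDomain.gcd e h, ?_, EuclideanDomain.gcd_dvd_left _ _,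
      EuclideanDomain.gcd_dvd_right _ _, EuclideanDomain.gcdA e h, EuclideanDomain.gcdB e h, ?_⟩
    · intro h0
      exact he.1.ne_zero (EuclideanDomain.gcd_eq_zero_iff.1 h0).1
    · rw [EuclideanDomain.gcd_eq_gcd_ab]; ring
  set g := g0 * C (g0.leadingCoeff)⁻¹ with hgdef
  have hgm : g.Monic := monic_mul_leadingCoeff_inv hg0
  have hu : IsUnit (C (g0.leadingCoeff)⁻¹ : F[X]) :=
    isUnit_C.2 (isUnit_iff_ne_zero.2 (inv_ne_zero (leadingCoeff_ne_zero.2 hg0)))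
  obtain ⟨e', rfl⟩ : g ∣ e := hu.mul_right_dvd.2 hge
  obtain ⟨h', rfl⟩ : g ∣ h := hu.mul_right_dvd.2 hgh
  have he'm : e'.Monic := hgm.of_mul_monic_left he.1
  have hdeg : g.natDegree + e'.natDegree = d := by
    rw [← he.2.1, hgm.natDegree_mul he'm]
  have hc0 : g.coeff 0 ≠ 0 ∧ e'.coeff 0 ≠ 0 := by
    have := he.2.2
    rw [mul_coeff_zero] at this
    exact ⟨left_ne_zero_of_mul this, right_ne_zero_of_mul this⟩
  refine ⟨⟨⟨g.natDegree, by omega⟩, ⟨g, hgm, rfl, hc0.1⟩, ⟨(e', h'), ⟨he'm, ?_, hc0.2⟩, ?_, ?_⟩⟩, rfl⟩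
  · simp only; omega
  · simp only
    rw [degree_mul, ← hdeg, degree_eq_natDegree hgm.ne_zero] at hd
    push_cast at hd
    have := lt_of_add_lt_add_left hd
    rwa [← hdeg, Nat.add_sub_cancel_left]
  · refine ⟨C (g0.leadingCoeff)⁻¹ * a, C (g0.leadingCoeff)⁻¹ * b, ?_⟩
    apply mul_left_cancel₀ hgm.ne_zero
    dsimp only
    linear_combination C (g0.leadingCoeff)⁻¹ * hab

lemma finite_CopSet [Finite F] (d : ℕ) : Finite (CopSet F d) := by
  have : Finite (degreeLT F d) := Finite.of_equiv _ (degreeLTEquiv F d).toEquiv.symm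
  have := finite_MonSet (F := F) d
  exact Finite.of_injective
    (fun p : CopSet F d => ((⟨p.1.1, p.2.1⟩, ⟨p.1.2, mem_degreeLT.2 p.2.2.1⟩) :
      MonSet F d × degreeLT F d)) (by
      rintro ⟨⟨a, b⟩, h⟩ ⟨⟨a', b'⟩, h'⟩ H
      simp only [Prod.mk.injEq, Subtype.mk.injEq] at H
      obtain ⟨rfl, rfl⟩ := H
      rfl)

theorem Ecount_rec [Finite F] (d : ℕ) :
    ∑ p ∈ Finset.HasAntidiagonal.antidiagonal d, Nat.card (MonSet F p.1) * Ecount F p.2 =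
      Nat.card (MonSet F d) * Nat.card F ^ d := by
  have := fun d => finite_MonSet (F := F) d
  have := fun d => finite_CopSet (F := F) d
  rw [← card_PairSet, ← Nat.card_congr (Equiv.ofBijective _ ⟨pairMap_injective (F := F) d,
    pairMap_surjective d⟩), Nat.card_sigma, Finset.Nat.sum_antidiagonal_eq_sum_range_succ
      (fun i j => Nat.card (MonSet F i) * Ecount F j), ← Fin.sum_univ_eq_sum_range
      (fun i => Nat.card (MonSet F i) * Ecount F (d - i))]
  exact Finset.sum_congr rfl fun i _ => by rw [Nat.card_prod, card_CopSet]

lemma card_MonSet_zero : Nat.card (MonSet F 0) = 1 := by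
  have : MonSet F 0 = {1} := by
    ext e
    constructor
    · rintro ⟨h, h1, h2⟩
      exact h.natDegree_eq_zero.1 h1
    · rintro rfl
      exact ⟨monic_one, natDegree_one, by simp⟩
  rw [this]; simp

lemma card_MonSet_succ (d : ℕ) :
    Nat.card (MonSet F (d + 1)) = Nat.card F ^ d * (Nat.card F - 1) := by
  have h1 : Nat.card {p : F[X] // p.Monic ∧ p.natDegree = d} = Nat.card F ^ d := by
    rw [Nat.card_congr (monicEquivDegreeLT d), card_degreeLT]
  have h2 : Nat.card Fˣ = Nat.card F - 1 := Nat.card_units F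
  rw [← h1, ← h2, ← Nat.card_prod]
  symm
  have hd : ∀ p : F[X], p.Monic → ∀ c : F, (C c).degree < (p * X).degree := by
    intro p hp c
    refine degree_C_le.trans_lt ?_
    rw [degree_mul, degree_X, degree_eq_natDegree hp.ne_zero]
    exact_mod_cast Nat.succ_pos _
  refine Nat.card_congr (Equiv.ofBijective (fun x => ⟨x.1.1 * X + C (x.2 : F), ?_, ?_, ?_⟩) ⟨?_, ?_⟩)
  · exact (x.1.2.1.mul monic_X).add_of_left (hd _ x.1.2.1 _)
  · rw [natDegree_add_C, x.1.2.1.natDegree_mul monic_X, x.1.2.2, natDegree_X]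
  · simp
  · rintro ⟨⟨p, hp⟩, u⟩ ⟨⟨p', hp'⟩, u'⟩ H
    have H := congrArg Subtype.val H
    dsimp only at H
    have e2 := congrArg (fun p => coeff p 0) H
    simp at e2
    have e3 : u = u' := Units.ext e2
    subst e3
    have e1 := mul_right_cancel₀ X_ne_zero (add_right_cancel H)
    subst e1
    rfl
  · rintro ⟨e, he, hd, h0⟩
    have hne : e.divX.natDegree = d := by rw [natDegree_divX_eq_natDegree_tsub_one, hd]; rfl
    refine ⟨⟨⟨e.divX, ?_, hne⟩, Units.mk0 _ h0⟩, ?_⟩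
    · rw [Monic, leadingCoeff, hne, coeff_divX, ← hd]; exact he
    · exact Subtype.ext (divX_mul_X_add e)

end Ecount
end LaurentCount

namespace LaurentCount
open Polynomial

section Transfer
variable {F : Type*} [Field F]

lemma exists_monic_of_card [Finite F] {n : ℕ} {I : Ideal F[X][X]}
    (h : Nat.card (F[X][X] ⧸ I) = Nat.card F ^ n) : ∃ f ∈ I, f.Monic ∧ f.natDegree = n := by
  have hfin : Finite (F[X][X] ⧸ I) := Nat.finite_of_card_ne_zero (by
    rw [h]; exact pow_ne_zero _ Nat.card_pos.ne')
  have : Module.Finite F (F[X][X] ⧸ I) := Module.Finite.of_finite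
  have hr : Module.finrank F (F[X][X] ⧸ I) = n :=
    Nat.pow_right_injective (one_lt_q (F := F)) (by
      dsimp only; rw [← h]; exact (Module.natCard_eq_pow_finrank (K := F)).symm)
  set x : F[X][X] ⧸ I := Ideal.Quotient.mk I X with hx
  set p := (Algebra.lmul F (F[X][X] ⧸ I) x).charpoly with hp
  have h1 : aeval x p = 0 := by
    have := LinearMap.aeval_self_charpoly (Algebra.lmul F (F[X][X] ⧸ I) x)
    rw [← hp, aeval_algHom_apply] at this
    have h2 := congrArg (fun f => f 1) this
    exact (mul_one _).symm.trans h2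
  refine ⟨p.map C, ?_, (LinearMap.charpoly_monic _).map _, ?_⟩
  · rw [← Ideal.Quotient.eq_zero_iff_mem, ← h1]
    have : (Ideal.Quotient.mk I).comp (mapRingHom C) = (aeval x : F[X] →ₐ[F] _).toRingHom := by
      apply Polynomial.ringHom_ext'
      · ext a
        simp
        rfl
      · simp [hx]
    exact RingHom.congr_fun this p
  · rw [(LinearMap.charpoly_monic _).natDegree_map, LinearMap.charpoly_natDegree, hr]

lemma mem_XSet_iff [Finite F] {n : ℕ} {I : Ideal F[X][X]} :
    I ∈ XSet F n n ↔ Good I ∧ Nat.card (F[X][X] ⧸ I) = Nat.card F ^ n :=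
  ⟨fun h => h.2, fun h => ⟨exists_monic_of_card h.2, h⟩⟩

variable (F) in
abbrev LA := AddMonoidAlgebra F (ℤ × ℤ)

variable (F) in
noncomputable def phi : F[X][X] →+* LA F :=
  eval₂RingHom (eval₂RingHom (algebraMap F (LA F)) (AddMonoidAlgebra.single (1, 0) 1))
    (AddMonoidAlgebra.single (0, 1) 1)

lemma phi_X : phi F X = AddMonoidAlgebra.single (0, 1) 1 := by simp [phi]
lemma phi_CX : phi F (C X) = AddMonoidAlgebra.single (1, 0) 1 := by simp [phi]
lemma phi_CC (a : F) : phi F (C (C a)) = AddMonoidAlgebra.single 0 a := by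
  simp [phi]

lemma phi_t_pow (N : ℕ) : phi F (X * C X) ^ N = AddMonoidAlgebra.single ((N : ℤ), (N : ℤ)) 1 := by
  rw [map_mul, phi_X, phi_CX, AddMonoidAlgebra.single_mul_single, AddMonoidAlgebra.single_pow]
  simp

lemma exists_phi (a : LA F) : ∃ (N : ℕ) (s : F[X][X]), phi F (X * C X) ^ N * a = phi F s := by
  induction a using AddMonoidAlgebra.induction_linear with
  | zero => exact ⟨0, 0, by simp⟩
  | add a b ha hb =>
    obtain ⟨N, s, hs⟩ := ha
    obtain ⟨M, r, hr⟩ := hb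
    refine ⟨N + M, (X * C X) ^ M * s + (X * C X) ^ N * r, ?_⟩
    rw [map_add, map_mul _ _ s, map_mul _ _ r, map_pow, map_pow, ← hs, ← hr]
    ring
  | single m c =>
    obtain ⟨i, j⟩ := m
    obtain ⟨a, ha⟩ := Int.eq_ofNat_of_zero_le (a := i + (i.natAbs + j.natAbs : ℕ)) (by omega)
    obtain ⟨b, hb⟩ := Int.eq_ofNat_of_zero_le (a := j + (i.natAbs + j.natAbs : ℕ)) (by omega)
    refine ⟨i.natAbs + j.natAbs, C (C c) * (C X) ^ a * X ^ b, ?_⟩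
    rw [phi_t_pow, map_mul, map_mul, map_pow, map_pow, phi_X, phi_CX, phi_CC,
      AddMonoidAlgebra.single_pow, AddMonoidAlgebra.single_pow, AddMonoidAlgebra.single_mul_single,
      AddMonoidAlgebra.single_mul_single, AddMonoidAlgebra.single_mul_single]
    congr 1
    · ext
      · simp only [Prod.fst_add, Prod.smul_mk, nsmul_eq_mul, mul_one, mul_zero, Prod.fst_zero]
        omega
      · simp only [Prod.snd_add, Prod.smul_mk, nsmul_eq_mul, mul_one, mul_zero, Prod.snd_zero]
        omega
    · simp

lemma isUnit_single (m : ℤ × ℤ) : IsUnit (AddMonoidAlgebra.single m 1 : LA F) :=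
  IsUnit.of_mul_eq_one (AddMonoidAlgebra.single (-m) 1) (by
    rw [AddMonoidAlgebra.single_mul_single, AddMonoidAlgebra.one_def]; simp)

lemma isUnit_phi_X : IsUnit (phi F X) := by rw [phi_X]; exact isUnit_single _
lemma isUnit_phi_CX : IsUnit (phi F (C X)) := by rw [phi_CX]; exact isUnit_single _
lemma isUnit_phi_t : IsUnit (phi F (X * C X)) := by
  rw [map_mul]; exact isUnit_phi_X.mul isUnit_phi_CX

lemma exists_pow_of_isUnit {M : Type*} [Monoid M] [Finite M] {u : M} (hu : IsUnit u) :
    ∃ k, u ^ (k + 1) = 1 := by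
  obtain ⟨v, rfl⟩ := hu
  obtain ⟨n, hn, h⟩ := (isOfFinOrder_of_finite v).exists_pow_eq_one
  obtain ⟨k, rfl⟩ := Nat.exists_eq_succ_of_ne_zero hn.ne'
  exact ⟨k, by rw [← Units.val_pow_eq_pow_val, h, Units.val_one]⟩

lemma comap_good {I : Ideal (LA F)} [Finite (LA F ⧸ I)] : Good (I.comap (phi F)) := by
  have key : ∀ s : F[X][X], IsUnit (phi F s) → ∃ r, 1 - s * r ∈ I.comap (phi F) := by
    intro s hs
    obtain ⟨k, hk⟩ := exists_pow_of_isUnit (hs.map (Ideal.Quotient.mk I))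
    refine ⟨s ^ k, ?_⟩
    rw [Ideal.mem_comap, map_sub, map_one, ← pow_succ', ← Ideal.Quotient.eq_zero_iff_mem, map_sub,
      map_pow, map_pow, hk, map_one, sub_self]
  exact ⟨key _ isUnit_phi_X, key _ isUnit_phi_CX⟩

lemma comap_card {I : Ideal (LA F)} [Finite (LA F ⧸ I)] :
    Nat.card (F[X][X] ⧸ I.comap (phi F)) = Nat.card (LA F ⧸ I) := by
  refine Nat.card_congr (Equiv.ofBijective (Ideal.quotientMap I (phi F) le_rfl)
    ⟨Ideal.quotientMap_injective, ?_⟩)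
  intro a
  obtain ⟨a, rfl⟩ := Ideal.Quotient.mk_surjective a
  obtain ⟨N, s, hs⟩ := exists_phi a
  obtain ⟨k, hk⟩ := exists_pow_of_isUnit ((isUnit_phi_t (F := F)).map (Ideal.Quotient.mk I))
  refine ⟨Ideal.Quotient.mk _ ((X * C X) ^ (k * N) * s), ?_⟩
  rw [Ideal.quotientMap_mk, map_mul, ← hs, map_pow, ← mul_assoc, ← pow_add, map_mul, map_pow,
    show k * N + N = (k + 1) * N by ring, pow_mul, hk, one_pow, one_mul]

lemma comap_phi_injective : Function.Injective (fun I : Ideal (LA F) => I.comap (phi F)) := by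
  have key : ∀ I J : Ideal (LA F), I.comap (phi F) = J.comap (phi F) → I ≤ J := by
    intro I J h a ha
    obtain ⟨N, s, hs⟩ := exists_phi a
    have h1 : s ∈ I.comap (phi F) := by
      rw [Ideal.mem_comap, ← hs]; exact I.mul_mem_left _ ha
    rw [h, Ideal.mem_comap, ← hs] at h1
    obtain ⟨b, hb⟩ := ((isUnit_phi_t (F := F)).pow N).exists_left_inv
    have := J.mul_mem_left b h1
    rwa [← mul_assoc, hb, one_mul] at this
  exact fun I J h => le_antisymm (key I J h) (key J I h.symm)

lemma isUnit_mk_of {R : Type*} [CommRing R] {I : Ideal R} {s r : R} (h : 1 - s * r ∈ I) :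
    IsUnit (Ideal.Quotient.mk I s) :=
  IsUnit.of_mul_eq_one (Ideal.Quotient.mk I r) (by
    rw [← map_mul, ← map_one (Ideal.Quotient.mk I)]
    exact ((Ideal.Quotient.eq).2 h).symm)

/-- the character `(i,j) ↦ u^i v^j` -/
def unitChar {M : Type*} [CommRing M] (u v : Mˣ) : Multiplicative (ℤ × ℤ) →* M where
  toFun m := ((u ^ (m.toAdd.1) * v ^ (m.toAdd.2) : Mˣ) : M)
  map_one' := by simp
  map_mul' a b := by
    rw [← Units.val_mul]
    congr 1
    simp only [toAdd_mul, Prod.fst_add, Prod.snd_add, zpow_add]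
    exact mul_mul_mul_comm _ _ _ _

lemma exists_comap {K : Ideal F[X][X]} (hK : Good K) : ∃ I : Ideal (LA F), I.comap (phi F) = K ∧
    (Finite (F[X][X] ⧸ K) → Finite (LA F ⧸ I)) := by
  obtain ⟨⟨r, hr⟩, ⟨r', hr'⟩⟩ := hK
  obtain ⟨u, hu⟩ := isUnit_mk_of hr'
  obtain ⟨v, hv⟩ := isUnit_mk_of hr
  set psi := AddMonoidAlgebra.lift F (F[X][X] ⧸ K) (ℤ × ℤ) (unitChar (M := F[X][X] ⧸ K) u v) with hpsi
  have h : psi.toRingHom.comp (phi F) = Ideal.Quotient.mk K := by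
    apply Polynomial.ringHom_ext'
    · apply Polynomial.ringHom_ext'
      · ext a
        have : psi (phi F (C (C a))) = Ideal.Quotient.mk K (C (C a)) := by
          rw [phi_CC, hpsi, AddMonoidAlgebra.lift_single, ofAdd_zero, map_one]
          exact (Algebra.algebraMap_eq_smul_one (A := F[X][X] ⧸ K) a).symm
        exact this
      · have : psi (phi F (C X)) = Ideal.Quotient.mk K (C X) := by
          rw [phi_CX, hpsi, AddMonoidAlgebra.lift_single, one_smul, ← hu]
          simp [unitChar]
        exact this
    · have : psi (phi F X) = Ideal.Quotient.mk K X := by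
        rw [phi_X, hpsi, AddMonoidAlgebra.lift_single, one_smul, ← hv]
        simp [unitChar]
      exact this
  refine ⟨RingHom.ker psi.toRingHom, ?_, fun hf =>
    Finite.of_injective _ (RingHom.kerLift_injective psi.toRingHom)⟩
  rw [RingHom.comap_ker, h, Ideal.mk_ker]

lemma finrank_eq_iff [Finite F] {V : Type*} [AddCommGroup V] [Module F V] {n : ℕ} (hn : 1 ≤ n) :
    Module.finrank F V = n ↔ Nat.card V = Nat.card F ^ n := by
  constructor
  · intro h
    have : Module.Finite F V := Module.finite_of_finrank_pos (by omega)
    rw [Module.natCard_eq_pow_finrank (K := F), h]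
  · intro h
    have hfin : Finite V := Nat.finite_of_card_ne_zero (by
      rw [h]; exact pow_ne_zero _ Nat.card_pos.ne')
    have : Module.Finite F V := Module.Finite.of_finite
    exact Nat.pow_right_injective (one_lt_q (F := F)) (by
      dsimp only; rw [← h]; exact (Module.natCard_eq_pow_finrank (K := F)).symm)

theorem transfer [Finite F] {n : ℕ} (hn : 1 ≤ n) :
    Finite {I : Ideal (LA F) // Module.finrank F (LA F ⧸ I) = n} ∧
    Nat.card {I : Ideal (LA F) // Module.finrank F (LA F ⧸ I) = n} = Nat.card (XSet F n n) := by
  have hfin : ∀ I : Ideal (LA F), Module.finrank F (LA F ⧸ I) = n → Finite (LA F ⧸ I) :=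
    fun I h => by
      have : Module.Finite F (LA F ⧸ I) := Module.finite_of_finrank_pos (by omega)
      exact Module.finite_of_finite F
  have E : {I : Ideal (LA F) // Module.finrank F (LA F ⧸ I) = n} ≃ XSet F n n := by
    refine Equiv.ofBijective (fun I => ⟨I.1.comap (phi F), ?_⟩) ⟨?_, ?_⟩
    · have := hfin I.1 I.2
      exact mem_XSet_iff.2 ⟨comap_good, by rw [comap_card, (finrank_eq_iff hn).1 I.2]⟩
    · intro I J h
      exact Subtype.ext (comap_phi_injective (congrArg Subtype.val h))
    · rintro ⟨K, hK⟩
      obtain ⟨hg, hc⟩ := mem_XSet_iff.1 hK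
      obtain ⟨I, rfl, hI⟩ := exists_comap hg
      refine ⟨⟨I, (finrank_eq_iff hn).2 ?_⟩, rfl⟩
      have hS : Finite (F[X][X] ⧸ I.comap (phi F)) := Nat.finite_of_card_ne_zero (by
        rw [hc]; exact pow_ne_zero _ Nat.card_pos.ne')
      have : Finite (LA F ⧸ I) := hI hS
      rw [← comap_card, hc]
  have := finite_XSet (F := F) n n
  exact ⟨Finite.of_equiv _ E.symm, Nat.card_congr E⟩

end Transfer
end LaurentCount

namespace LaurentCount
open Finset

section FieldIdentity
variable {K : Type*} [Field K]

/-- coefficient appearing in the finite partial fraction expansion -/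
def pfc (t : K) (N k : ℕ) : K := ∏ j ∈ range k, (1 - t ^ (N - j)) / (1 - t ^ (N + 1 + j))

lemma pfc_succ_left (t : K) (ht : ∀ j : ℕ, 1 ≤ j → t ^ j ≠ 1) (N k : ℕ) (hk : k ≤ N) :
    pfc t (N + 1) k = pfc t N k *
      ((1 - t ^ (N + 1)) ^ 2 / ((1 - t ^ (N + 1 - k)) * (1 - t ^ (N + 1 + k)))) := by
  have h1 : ∀ j : ℕ, 1 ≤ j → 1 - t ^ j ≠ 0 := fun j hj => sub_ne_zero.2 (ht j hj).symm
  induction k with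
  | zero =>
    have := h1 (N + 1) (by omega)
    simp only [pfc, range_zero, prod_empty, Nat.sub_zero, Nat.add_zero, one_mul]
    field_simp
  | succ k ih =>
    have e1 : pfc t (N + 1) (k + 1) = pfc t (N + 1) k *
        ((1 - t ^ (N + 1 - k)) / (1 - t ^ (N + 1 + 1 + k))) := by
      simp only [pfc, prod_range_succ]
    have e2 : pfc t N (k + 1) = pfc t N k * ((1 - t ^ (N - k)) / (1 - t ^ (N + 1 + k))) := by
      simp only [pfc, prod_range_succ]
    rw [e1, e2, ih (by omega)]
    have a1 := h1 (N + 1 - k) (by omega)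
    have a2 := h1 (N + 1 + k) (by omega)
    have a3 := h1 (N + 1 + 1 + k) (by omega)
    have a4 := h1 (N - k) (by omega)
    have e3 : N + 1 - (k + 1) = N - k := by omega
    have e4 : N + 1 + (k + 1) = N + 1 + 1 + k := by omega
    rw [e3, e4]
    field_simp

lemma tri_succ (k : ℕ) : (k + 1) * (k + 1 + 1) / 2 = k * (k + 1) / 2 + (k + 1) := by
  have : (k + 1) * (k + 1 + 1) = k * (k + 1) + (k + 1) * 2 := by ring
  rw [this, Nat.add_mul_div_right _ _ (by norm_num)]

lemma pf_telescope (t : K) (ht : ∀ j : ℕ, 1 ≤ j → t ^ j ≠ 1) (M : ℕ) (hM : 1 ≤ M) (k : ℕ)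
    (hk : k ≤ M) :
    ∑ i ∈ range k, (-1) ^ (i + 1) * t ^ (i * (i + 1) / 2) * (1 + t ^ (i + 1)) * pfc t M (i + 1)
      = (-1) ^ k * t ^ (k * (k + 1) / 2) * pfc t M k * (1 - t ^ (M - k)) / (1 - t ^ M) - 1 := by
  have h1 : ∀ j : ℕ, 1 ≤ j → 1 - t ^ j ≠ 0 := fun j hj => sub_ne_zero.2 (ht j hj).symm
  have hM1 := h1 M hM
  induction k with
  | zero => simp [pfc, hM1]
  | succ k ih =>
    rw [sum_range_succ, ih (by omega), tri_succ]
    have e2 : pfc t M (k + 1) = pfc t M k * ((1 - t ^ (M - k)) / (1 - t ^ (M + 1 + k))) := by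
      simp only [pfc, prod_range_succ]
    have a1 := h1 (M - k) (by omega)
    have a2 := h1 (M + 1 + k) (by omega)
    rw [e2]
    obtain ⟨r, rfl⟩ : ∃ r, M = k + 1 + r := ⟨M - (k + 1), by omega⟩
    have e3 : k + 1 + r - k = r + 1 := by omega
    have e4 : k + 1 + r - (k + 1) = r := by omega
    rw [e3] at *
    rw [e4]
    field_simp
    ring

lemma pf_identity (t z : K) (hz : z ≠ 0) (ht : ∀ j : ℕ, 1 ≤ j → t ^ j ≠ 1)
    (h1 : ∀ k : ℕ, 1 ≤ k → 1 - z * t ^ k ≠ 0) (h2 : ∀ k : ℕ, 1 ≤ k → 1 - z⁻¹ * t ^ k ≠ 0)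
    (N : ℕ) :
    ∏ k ∈ range N, (1 - t ^ (k + 1)) ^ 2 / ((1 - z * t ^ (k + 1)) * (1 - z⁻¹ * t ^ (k + 1))) =
      1 + ∑ k ∈ range N, (-1) ^ (k + 1) * t ^ ((k + 1) * (k + 1 + 1) / 2) * pfc t N (k + 1) *
        ((1 - z) / (1 - z * t ^ (k + 1)) + (1 - z⁻¹) / (1 - z⁻¹ * t ^ (k + 1))) := by
  have h0 : ∀ j : ℕ, 1 ≤ j → 1 - t ^ j ≠ 0 := fun j hj => sub_ne_zero.2 (ht j hj).symm
  induction N with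
  | zero => simp
  | succ N ih =>
    rw [prod_range_succ, ih, add_mul, one_mul, sum_mul]
    have key : ∀ k ∈ range N,
        (-1) ^ (k + 1) * t ^ ((k + 1) * (k + 1 + 1) / 2) * pfc t N (k + 1) *
        ((1 - z) / (1 - z * t ^ (k + 1)) + (1 - z⁻¹) / (1 - z⁻¹ * t ^ (k + 1))) *
        ((1 - t ^ (N + 1)) ^ 2 / ((1 - z * t ^ (N + 1)) * (1 - z⁻¹ * t ^ (N + 1)))) =
        (-1) ^ (k + 1) * t ^ ((k + 1) * (k + 1 + 1) / 2) * pfc t (N + 1) (k + 1) *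
        ((1 - z) / (1 - z * t ^ (k + 1)) + (1 - z⁻¹) / (1 - z⁻¹ * t ^ (k + 1))) -
        ((-1) ^ (k + 1) * t ^ (k * (k + 1) / 2) * (1 + t ^ (k + 1)) * pfc t (N + 1) (k + 1)) *
          (t ^ (N + 1) * (2 - z - z⁻¹) / ((1 - z * t ^ (N + 1)) * (1 - z⁻¹ * t ^ (N + 1)))) := by
      intro k hk
      have hk' : k + 1 ≤ N := by simpa [Nat.succ_le_iff] using hk
      rw [pfc_succ_left t ht N (k + 1) hk', tri_succ]
      obtain ⟨r, rfl⟩ : ∃ r, N = k + 1 + r := ⟨N - (k + 1), by omega⟩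
      have b1 := h1 (k + 1) (by omega)
      have b2 := h2 (k + 1) (by omega)
      have b3 := h1 (k + 1 + r + 1) (by omega)
      have b4 := h2 (k + 1 + r + 1) (by omega)
      have e3 : k + 1 + r + 1 - (k + 1) = r + 1 := by omega
      have b5 := h0 (r + 1) (by omega)
      have b6 := h0 (k + 1 + r + 1 + (k + 1)) (by omega)
      rw [e3]
      have c2 : z - t ^ (k + 1) ≠ 0 := by
        intro h; apply b2; field_simp; simpa using h
      have c4 : z - t ^ (k + 1 + r + 1) ≠ 0 := by
        intro h; apply b4; field_simp; simpa using h
      have w1 : (1 - z) / (1 - z * t ^ (k + 1)) + (1 - z⁻¹) / (1 - z⁻¹ * t ^ (k + 1)) =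
          (2 - z - z⁻¹) * (1 + t ^ (k + 1)) / ((1 - z * t ^ (k + 1)) * (1 - z⁻¹ * t ^ (k + 1))) := by
        rw [div_add_div _ _ b1 b2]
        congr 1
        field_simp
        ring
      have w2 : (1 : K) / ((1 - z * t ^ (k + 1)) * (1 - z⁻¹ * t ^ (k + 1))) *
          (1 / ((1 - z * t ^ (k + 1 + r + 1)) * (1 - z⁻¹ * t ^ (k + 1 + r + 1)))) =
          (1 / ((1 - t ^ (r + 1)) * (1 - t ^ (k + 1 + r + 1 + (k + 1))))) *
          (1 / ((1 - z * t ^ (k + 1)) * (1 - z⁻¹ * t ^ (k + 1))) - t ^ (r + 1) *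
          (1 / ((1 - z * t ^ (k + 1 + r + 1)) * (1 - z⁻¹ * t ^ (k + 1 + r + 1))))) := by
        field_simp
        ring
      rw [w1]
      calc _ = (-1) ^ (k + 1) * t ^ (k * (k + 1) / 2 + (k + 1)) * pfc t (k + 1 + r) (k + 1) *
            ((2 - z - z⁻¹) * (1 + t ^ (k + 1))) * (1 - t ^ (k + 1 + r + 1)) ^ 2 *
            ((1 : K) / ((1 - z * t ^ (k + 1)) * (1 - z⁻¹ * t ^ (k + 1))) *
          (1 / ((1 - z * t ^ (k + 1 + r + 1)) * (1 - z⁻¹ * t ^ (k + 1 + r + 1))))) := by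
            generalize 1 - z⁻¹ * t ^ (k + 1 + r + 1) = A
            generalize 1 - z * t ^ (k + 1 + r + 1) = B
            generalize 1 - z⁻¹ * t ^ (k + 1) = A'
            generalize 1 - z * t ^ (k + 1) = B'
            ring
        _ = _ := by
            rw [w2]
            have : t ^ (k + 1 + r + 1) = t ^ (k + 1) * t ^ (r + 1) := by ring
            have h3 : t ^ (k * (k + 1) / 2 + (k + 1)) = t ^ (k * (k + 1) / 2) * t ^ (k + 1) :=
              pow_add _ _ _
            rw [h3]
            generalize 1 - z⁻¹ * t ^ (k + 1 + r + 1) = A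
            generalize 1 - z * t ^ (k + 1 + r + 1) = B
            generalize 1 - z⁻¹ * t ^ (k + 1) = A'
            generalize 1 - z * t ^ (k + 1) = B'
            rw [this]
            ring
    rw [sum_congr rfl key, sum_sub_distrib, ← sum_mul,
      ]
    have T := pf_telescope t ht (N + 1) (by omega) (N + 1) le_rfl
    rw [sum_range_succ] at T
    simp only [Nat.sub_self, pow_zero, sub_self, mul_zero, zero_div, zero_sub] at T
    rw [eq_sub_of_add_eq T, sum_range_succ, tri_succ]
    have b3 := h1 (N + 1) (by omega)
    have b4 := h2 (N + 1) (by omega)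
    have c4 : z - t ^ (N + 1) ≠ 0 := by
      intro h; apply b4; field_simp; simpa using h
    rw [pow_add t (N * (N + 1) / 2) (N + 1)]
    generalize (∑ k ∈ range N, (-1) ^ (k + 1) * t ^ ((k + 1) * (k + 1 + 1) / 2) * pfc t (N + 1) (k + 1) *
        ((1 - z) / (1 - z * t ^ (k + 1)) + (1 - z⁻¹) / (1 - z⁻¹ * t ^ (k + 1)))) = Sg
    generalize pfc t (N + 1) (N + 1) = c
    generalize t ^ (N * (N + 1) / 2) = u
    generalize (-1 : K) ^ (N + 1) = s
    generalize t ^ (N + 1) = y at *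
    have b3' : 1 - y * z ≠ 0 := by rwa [mul_comm]
    field_simp
    ring

end FieldIdentity
end LaurentCount

namespace LaurentCount
open PowerSeries

section Series

lemma E_series (q : ℚ) (T E : ℕ → ℚ) (hT0 : T 0 = 1) (hT : ∀ d, T (d + 1) = q ^ d * (q - 1))
    (hE : ∀ d, ∑ p ∈ Finset.HasAntidiagonal.antidiagonal d, T p.1 * E p.2 = T d * q ^ d) :
    PowerSeries.mk E * ((1 - X) * (1 - C (q ^ 2) * X)) = (1 - C q * X) ^ 2 := by
  have h1 : PowerSeries.mk T * (1 - C q * X) = 1 - X := by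
    ext n
    rcases n with _ | _ | n
    · simp [hT0]
    · rw [mul_sub, mul_one, mul_left_comm, map_sub, coeff_C_mul, coeff_succ_mul_X]
      simp [hT0, hT, coeff_one]
    · rw [mul_sub, mul_one, mul_left_comm, map_sub, coeff_C_mul, coeff_succ_mul_X]
      simp [hT, coeff_one, coeff_X]
      ring
  have h2 : PowerSeries.mk (fun d => T d * q ^ d) * (1 - C (q ^ 2) * X) = 1 - C q * X := by
    ext n
    rcases n with _ | _ | n
    · simp [hT0]
    · rw [mul_sub, mul_one, mul_left_comm, map_sub, coeff_C_mul, coeff_succ_mul_X]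
      simp [hT0, hT, coeff_one]
      ring
    · rw [mul_sub, mul_one, mul_left_comm, map_sub, coeff_C_mul, coeff_succ_mul_X]
      simp [hT, coeff_one]
      ring
  have h3 : PowerSeries.mk T * PowerSeries.mk E = PowerSeries.mk (fun d => T d * q ^ d) := by
    ext n
    rw [coeff_mul, coeff_mk, ← hE]
    simp
  rw [← h1]
  linear_combination (1 - C q * X) * (1 - C (q ^ 2) * X) * h3 + (1 - C q * X) * h2

lemma coeff_expand_mul_sum (m : ℕ) (f g : ℚ⟦X⟧) (n : ℕ) :
    coeff n (expand (m + 1) m.succ_ne_zero f * g) =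
      ∑ d ∈ (Finset.range (n + 1)).filter (fun d => (m + 1) * d ≤ n),
        coeff d f * coeff (n - (m + 1) * d) g := by
  rw [coeff_mul, Finset.Nat.sum_antidiagonal_eq_sum_range_succ
    (fun i j => coeff i (expand (m + 1) m.succ_ne_zero f) * coeff j g)]
  symm
  refine Finset.sum_of_injOn (fun d => (m + 1) * d) ?_ ?_ ?_ ?_
  · intro a _ b _ h
    exact Nat.eq_of_mul_eq_mul_left m.succ_pos h
  · intro d hd
    simp at hd ⊢
    omega
  · intro i hi hni
    rw [coeff_expand_of_not_dvd, zero_mul]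
    rintro ⟨d, rfl⟩
    apply hni
    simp at hi
    simp
    have : d ≤ (m + 1) * d := Nat.le_mul_of_pos_left _ m.succ_pos
    omega
  · intro d hd
    simp only [coeff_expand_mul]

lemma W_succ (q : ℚ) (E : ℕ → ℚ) (w : ℕ → ℕ → ℚ) (m : ℕ)
    (hw : ∀ n, w (m + 1) n = ∑ d ∈ (Finset.range (n + 1)).filter (fun d => (m + 1) * d ≤ n),
      E d * q ^ (m * d) * w m (n - (m + 1) * d)) :
    PowerSeries.mk (w (m + 1)) =
      expand (m + 1) m.succ_ne_zero (rescale (q ^ m) (PowerSeries.mk E)) * PowerSeries.mk (w m) := by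
  ext n
  rw [coeff_expand_mul_sum, coeff_mk, hw]
  refine Finset.sum_congr rfl fun d _ => ?_
  rw [coeff_rescale, coeff_mk, coeff_mk, pow_mul]
  ring

lemma expand_E (q : ℚ) (E : ℕ → ℚ) (m : ℕ) (hq : q ≠ 0)
    (hE : PowerSeries.mk E * ((1 - X) * (1 - C (q ^ 2) * X)) = (1 - C q * X) ^ 2) :
    expand (m + 1) m.succ_ne_zero (rescale (q ^ m) (PowerSeries.mk E)) *
      ((1 - C q * (C q * X) ^ (m + 1)) * (1 - C q⁻¹ * (C q * X) ^ (m + 1))) =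
      (1 - (C q * X) ^ (m + 1)) ^ 2 := by
  have h := congrArg (fun f => expand (m + 1) m.succ_ne_zero (rescale (q ^ m) f)) hE
  simp only [map_mul, map_sub, map_one, map_pow, rescale_X, expand_X, expand_C] at h
  have hC : ∀ a : ℚ, rescale (q ^ m) (C a) = C a := by
    intro a
    ext n
    rw [coeff_rescale, coeff_C]
    split_ifs with h
    · simp [h]
    · simp
  simp only [hC, expand_C] at h
  have hi : (C q⁻¹ : ℚ⟦X⟧) * C q = 1 := by rw [← map_mul, inv_mul_cancel₀ hq, map_one]
  have h1 : C q⁻¹ * (C q * X) ^ (m + 1) = (C q ^ m * X ^ (m + 1) : ℚ⟦X⟧) := by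
    rw [mul_pow, pow_succ (C q)]
    linear_combination C q ^ m * X ^ (m + 1) * hi
  rw [h1, mul_pow]
  rw [pow_succ (C q)]
  linear_combination h

lemma W_prod (q : ℚ) (hq : q ≠ 0) (E : ℕ → ℚ) (w : ℕ → ℕ → ℚ)
    (hE : PowerSeries.mk E * ((1 - X) * (1 - C (q ^ 2) * X)) = (1 - C q * X) ^ 2)
    (hw0 : ∀ n, w 0 n = if n = 0 then 1 else 0)
    (hw : ∀ m n, w (m + 1) n = ∑ d ∈ (Finset.range (n + 1)).filter (fun d => (m + 1) * d ≤ n),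
      E d * q ^ (m * d) * w m (n - (m + 1) * d)) (N : ℕ) :
    PowerSeries.mk (w N) * ∏ m ∈ Finset.range N,
      ((1 - C q * (C q * X) ^ (m + 1)) * (1 - C q⁻¹ * (C q * X) ^ (m + 1))) =
    ∏ m ∈ Finset.range N, (1 - (C q * X) ^ (m + 1)) ^ 2 := by
  induction N with
  | zero =>
    ext n
    simp [hw0, coeff_one]
  | succ N ih =>
    rw [Finset.prod_range_succ, Finset.prod_range_succ, ← ih, W_succ q E w N (hw N),
      ← expand_E q E N hq hE]
    ring

/-- the power series version of `pfc` -/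
noncomputable def pfs (q : ℚ) (N k : ℕ) : ℚ⟦X⟧ :=
  ∏ j ∈ Finset.range k, ((1 - (C q * X) ^ (N - j)) * (1 - (C q * X) ^ (N + 1 + j))⁻¹)

lemma const_one (q a : ℚ) (k : ℕ) (hk : 1 ≤ k) :
    constantCoeff (1 - C a * (C q * X) ^ k : ℚ⟦X⟧) ≠ 0 := by
  simp [show k ≠ 0 by omega]

lemma const_one' (q : ℚ) (k : ℕ) (hk : 1 ≤ k) :
    constantCoeff (1 - (C q * X) ^ k : ℚ⟦X⟧) ≠ 0 := by
  simp [show k ≠ 0 by omega]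

lemma map_inv_ps {K : Type*} [Field K] (f : ℚ⟦X⟧ →+* K) (a : ℚ⟦X⟧) (ha : constantCoeff a ≠ 0) :
    f a⁻¹ = (f a)⁻¹ := by
  refine eq_inv_of_mul_eq_one_left ?_
  rw [← map_mul, PowerSeries.inv_mul_cancel _ ha, map_one]

lemma W_pf (q : ℚ) (hq : q ≠ 0) (N : ℕ) (W : ℚ⟦X⟧)
    (hW : W * ∏ m ∈ Finset.range N,
      ((1 - C q * (C q * X) ^ (m + 1)) * (1 - C q⁻¹ * (C q * X) ^ (m + 1))) =
    ∏ m ∈ Finset.range N, (1 - (C q * X) ^ (m + 1)) ^ 2) :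
    W = 1 + ∑ k ∈ Finset.range N, (-1) ^ (k + 1) * (C q * X) ^ ((k + 1) * (k + 1 + 1) / 2) *
      pfs q N (k + 1) * ((1 - C q) * (1 - C q * (C q * X) ^ (k + 1))⁻¹ +
        (1 - C q⁻¹) * (1 - C q⁻¹ * (C q * X) ^ (k + 1))⁻¹) := by
  let K := FractionRing ℚ⟦X⟧
  let f : ℚ⟦X⟧ →+* K := algebraMap ℚ⟦X⟧ K
  have hf : Function.Injective f := IsFractionRing.injective ℚ⟦X⟧ K
  apply hf
  have hne : ∀ a : ℚ⟦X⟧, constantCoeff a ≠ 0 → f a ≠ 0 := by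
    intro a ha h
    rw [map_eq_zero_iff f hf] at h
    rw [h] at ha
    simp at ha
  have hz : f (C q) ≠ 0 := hne _ (by simpa using hq)
  have hzi : (f (C q))⁻¹ = f (C q⁻¹) := by
    symm
    refine eq_inv_of_mul_eq_one_left ?_
    rw [← map_mul, ← map_mul, inv_mul_cancel₀ hq, map_one, map_one]
  have H := pf_identity (f (C q * X)) (f (C q)) hz ?_ ?_ ?_ N
  · have h1 := congrArg f hW
    rw [map_mul, map_prod, map_prod] at h1
    have h2 : f W = ∏ k ∈ Finset.range N, (1 - (f (C q * X)) ^ (k + 1)) ^ 2 /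
        ((1 - f (C q) * (f (C q * X)) ^ (k + 1)) * (1 - (f (C q))⁻¹ * (f (C q * X)) ^ (k + 1))) := by
      rw [Finset.prod_div_distrib, eq_div_iff]
      · rw [hzi]
        simpa only [map_mul, map_sub, map_one, map_pow] using h1
      · refine Finset.prod_ne_zero_iff.2 fun k _ => mul_ne_zero ?_ ?_
        · have := hne _ (const_one q q (k + 1) (by omega))
          simpa only [map_mul, map_sub, map_one, map_pow] using this
        · rw [hzi]
          have := hne _ (const_one q q⁻¹ (k + 1) (by omega))
          simpa only [map_mul, map_sub, map_one, map_pow] using this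
    rw [h2, H, map_add, map_one, map_sum]
    congr 1
    refine Finset.sum_congr rfl fun k _ => ?_
    rw [map_mul, map_mul, map_mul, map_add, map_mul _ (1 - C q), map_mul _ (1 - C q⁻¹),
      map_inv_ps f _ (const_one q q (k + 1) (by omega)),
      map_inv_ps f _ (const_one q q⁻¹ (k + 1) (by omega)), hzi]
    have hp : f (pfs q N (k + 1)) = pfc (f (C q * X)) N (k + 1) := by
      rw [pfs, pfc, map_prod]
      refine Finset.prod_congr rfl fun j _ => ?_
      rw [map_mul, map_inv_ps f _ (const_one' q (N + 1 + j) (by omega)), div_eq_mul_inv]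
      simp only [map_sub, map_one, map_pow]
    rw [hp]
    simp only [map_sub, map_one, map_pow, map_neg, map_mul, div_eq_mul_inv]
  · intro j hj h
    have := hne _ (const_one' q j hj)
    rw [map_sub, map_pow, h, map_one, sub_self] at this
    exact this rfl
  · intro k hk
    have := hne _ (const_one q q k hk)
    simpa only [map_mul, map_sub, map_one, map_pow] using this
  · intro k hk
    rw [hzi]
    have := hne _ (const_one q q⁻¹ k hk)
    simpa only [map_mul, map_sub, map_one, map_pow] using this

lemma pfs_congr (q : ℚ) (N k : ℕ) (hk : k ≤ N) :
    (X : ℚ⟦X⟧) ^ (N + 1 - k) ∣ pfs q N k - 1 := by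
  set I : Ideal ℚ⟦X⟧ := Ideal.span {X ^ (N + 1 - k)} with hI
  rw [← Ideal.mem_span_singleton, ← hI, ← Ideal.Quotient.eq, map_one, pfs, map_prod]
  refine Finset.prod_eq_one fun j hj => ?_
  rw [Finset.mem_range] at hj
  have key : ∀ i, N + 1 - k ≤ i → Ideal.Quotient.mk I (1 - (C q * X) ^ i) = 1 := by
    intro i hi
    rw [← map_one (Ideal.Quotient.mk I), Ideal.Quotient.eq, hI, Ideal.mem_span_singleton]
    rw [show (1 - (C q * X) ^ i - 1 : ℚ⟦X⟧) = X ^ i * -(C q) ^ i by ring]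
    exact (pow_dvd_pow _ hi).mul_right _
  have h2 := congrArg (Ideal.Quotient.mk I)
    (PowerSeries.mul_inv_cancel _ (const_one' q (N + 1 + j) (by omega)))
  rw [map_mul, key _ (by omega), one_mul, map_one] at h2
  rw [map_mul, key _ (by omega), h2, one_mul]

lemma inv_geom (q z : ℚ) (k : ℕ) (hk : k ≠ 0) :
    (1 - C z * (C q * X) ^ k : ℚ⟦X⟧)⁻¹ =
      expand k hk (PowerSeries.mk fun j => (z * q ^ k) ^ j) := by
  have h0 : (PowerSeries.mk fun j => (z * q ^ k) ^ j) * (1 - C (z * q ^ k) * X) = (1 : ℚ⟦X⟧) := by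
    ext n
    rcases n with _ | n
    · simp
    · rw [mul_sub, mul_one, mul_left_comm, map_sub, coeff_C_mul, coeff_succ_mul_X]
      simp [coeff_one]
      ring
  have h1 := congrArg (expand k hk) h0
  rw [map_mul, map_sub, map_mul, expand_X, expand_C, map_one] at h1
  rw [PowerSeries.inv_eq_iff_mul_eq_one (const_one q z k (by omega))]
  refine Eq.trans ?_ h1
  congr 1
  simp only [map_mul, map_pow]
  ring

lemma coeff_term (q z : ℚ) (n k T : ℕ) (hk : k ≠ 0) :
    coeff n ((C q * X) ^ T * (1 - C z * (C q * X) ^ k : ℚ⟦X⟧)⁻¹) =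
      ∑ j ∈ Finset.range (n + 1), if n = T + k * j then q ^ n * z ^ j else 0 := by
  rw [inv_geom q z k hk, mul_pow, ← map_pow, mul_assoc, coeff_C_mul, coeff_X_pow_mul']
  by_cases h : ∃ j, n = T + k * j
  · obtain ⟨j, rfl⟩ := h
    rw [if_pos (by omega), Nat.add_sub_cancel_left, coeff_expand_mul, coeff_mk,
      Finset.sum_eq_single_of_mem j]
    · rw [if_pos rfl]; ring
    · have := Nat.le_mul_of_pos_left j (Nat.pos_of_ne_zero hk)
      simp; omega
    · intro b _ hb
      rw [if_neg]
      intro h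
      exact hb (Nat.eq_of_mul_eq_mul_left (Nat.pos_of_ne_zero hk) (by omega))
  · rw [Finset.sum_eq_zero]
    · split_ifs with hT
      · rw [coeff_expand_of_not_dvd, mul_zero]
        rintro ⟨j, hj⟩
        exact h ⟨j, by omega⟩
      · simp
    · intro j _
      exact if_neg fun h' => h ⟨j, h'⟩

end Series
end LaurentCount

namespace LaurentCount
open PowerSeries

lemma le_tri (k : ℕ) : k ≤ k * (k + 1) / 2 := by
  rw [Nat.le_div_iff_mul_le (by norm_num)]
  rcases k with _ | k
  · simp
  · nlinarith

lemma coeff_W (q : ℚ) (hq : q ≠ 0) (n : ℕ) (hn : 1 ≤ n) (W : ℚ⟦X⟧)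
    (hW : W * ∏ m ∈ Finset.range n,
      ((1 - C q * (C q * X) ^ (m + 1)) * (1 - C q⁻¹ * (C q * X) ^ (m + 1))) =
    ∏ m ∈ Finset.range n, (1 - (C q * X) ^ (m + 1)) ^ 2) :
    coeff n W = ∑ k ∈ Finset.range n, ∑ j ∈ Finset.range (n + 1),
      if n = (k + 1) * (k + 1 + 1) / 2 + (k + 1) * j then
        (-1) ^ (k + 1) * (q ^ n * ((1 - q) * q ^ j + (1 - q⁻¹) * q⁻¹ ^ j)) else 0 := by
  rw [W_pf q hq n W hW, map_add, coeff_one, if_neg (by omega), zero_add, map_sum]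
  refine Finset.sum_congr rfl fun k hk => ?_
  rw [Finset.mem_range] at hk
  set T := (k + 1) * (k + 1 + 1) / 2 with hT
  set A := (1 - C q * (C q * X) ^ (k + 1) : ℚ⟦X⟧)⁻¹ with hA
  set B := (1 - C q⁻¹ * (C q * X) ^ (k + 1) : ℚ⟦X⟧)⁻¹ with hB
  obtain ⟨r, hr⟩ := pfs_congr q n (k + 1) hk
  have hTk : k + 1 ≤ T := le_tri (k + 1)
  obtain ⟨s, hs⟩ : (X : ℚ⟦X⟧) ^ (k + 1) ∣ (C q * X) ^ T := by
    rw [mul_pow]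
    exact (pow_dvd_pow _ hTk).mul_left _
  have e1 : ((-1) ^ (k + 1) * (C q * X) ^ T * pfs q n (k + 1) *
      ((1 - C q) * A + (1 - C q⁻¹) * B) : ℚ⟦X⟧) =
      C ((-1) ^ (k + 1) * (1 - q)) * ((C q * X) ^ T * A) +
      C ((-1) ^ (k + 1) * (1 - q⁻¹)) * ((C q * X) ^ T * B) +
      X ^ (n + 1) * ((-1) ^ (k + 1) * s * r * ((1 - C q) * A + (1 - C q⁻¹) * B)) := by
    have h1 : (X : ℚ⟦X⟧) ^ (n + 1) = X ^ (k + 1) * X ^ (n + 1 - (k + 1)) := by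
      rw [← pow_add]; congr 1; omega
    have h2 : pfs q n (k + 1) = 1 + X ^ (n + 1 - (k + 1)) * r := by
      rw [← hr]; ring
    rw [h1, h2, hs]
    simp only [map_mul, map_sub, map_pow, map_neg, map_one]
    ring
  rw [e1, map_add, map_add, coeff_C_mul, coeff_C_mul, coeff_X_pow_mul', if_neg (by omega), add_zero,
    hA, hB, coeff_term q q n (k + 1) T (by omega), coeff_term q q⁻¹ n (k + 1) T (by omega),
    Finset.mul_sum, Finset.mul_sum, ← Finset.sum_add_distrib]
  refine Finset.sum_congr rfl fun j _ => ?_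
  split_ifs
  · ring
  · ring

lemma tri_iff (n k j : ℕ) :
    n = k * (k + 1) / 2 + k * j ↔ 2 * n = k * (k + 2 * j + 1) := by
  have h : 2 * (k * (k + 1) / 2) = k * (k + 1) :=
    Nat.mul_div_cancel' (Nat.even_mul_succ_self k).two_dvd
  have : k * (k + 2 * j + 1) = k * (k + 1) + 2 * (k * j) := by ring
  omega

/-- signed indicator -/
def sgi (n k j : ℕ) : ℚ := if 2 * n = k * (k + 2 * j + 1) then (-1) ^ k else 0

lemma sgi_zero {n k j : ℕ} (hk : 1 ≤ k) (h : n < k + j) : sgi n k j = 0 := by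
  rw [sgi, if_neg]
  intro h'
  have h1 : k * (k + 2 * j + 1) = k * (k + 1) + 2 * (k * j) := by ring
  have h2 : 1 * j ≤ k * j := Nat.mul_le_mul_right _ hk
  have h3 : k * 2 ≤ k * (k + 1) := Nat.mul_le_mul_left _ (by omega)
  omega

lemma cCoeff_zero_cast (n : ℕ) :
    (cCoeff n 0 : ℚ) = 2 * ∑ k ∈ Finset.Icc 1 n, sgi n k 0 := by
  rw [cCoeff, if_pos rfl, Finset.mul_sum]
  push_cast
  symm
  refine (Finset.sum_subset (Finset.Icc_subset_Icc_right (by omega : n ≤ 2 * n)) ?_).trans ?_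
  · intro k hk hk'
    simp only [Finset.mem_Icc] at hk hk'
    rw [sgi_zero hk.1 (by omega), mul_zero]
  · refine Finset.sum_congr rfl fun k _ => ?_
    simp [sgi]

lemma cCoeff_succ_cast (n i : ℕ) :
    (cCoeff n (i + 1) : ℚ) = ∑ k ∈ Finset.Icc 1 n, (sgi n k (i + 1) - sgi n k i) := by
  rw [cCoeff, if_neg (by omega)]
  push_cast
  symm
  refine (Finset.sum_subset (Finset.Icc_subset_Icc_right (by omega : n ≤ 2 * n)) ?_).trans ?_
  · intro k hk hk'
    simp only [Finset.mem_Icc] at hk hk'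
    rw [sgi_zero hk.1 (by omega), sgi_zero hk.1 (by omega), sub_zero]
  · refine Finset.sum_congr rfl fun k hk => ?_
    simp only [Finset.mem_Icc] at hk
    rw [sgi, sgi, sub_eq_add_neg, show k + 2 * (i + 1) - 1 = k + 2 * i + 1 by omega]
    congr 1
    obtain ⟨l, rfl⟩ := Nat.exists_eq_add_of_le hk.1
    split_ifs
    · rw [Nat.add_sub_cancel_left, pow_add]; ring
    · simp

lemma final_sum (q : ℚ) (hq : q ≠ 0) (n : ℕ) (hn : 1 ≤ n) :
    (∑ k ∈ Finset.range n, ∑ j ∈ Finset.range (n + 1),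
      if n = (k + 1) * (k + 1 + 1) / 2 + (k + 1) * j then
        (-1) ^ (k + 1) * (q ^ n * ((1 - q) * q ^ j + (1 - q⁻¹) * q⁻¹ ^ j)) else 0) =
    (cCoeff n 0 : ℚ) * q ^ n +
      ∑ i ∈ Finset.Icc 1 n, (cCoeff n i : ℚ) * (q ^ (n + i) + q ^ (n - i)) := by
  set f : ℕ → ℚ := fun j => q ^ n * (q ^ j + q⁻¹ ^ j) with hf
  have hf0 : f 0 = 2 * q ^ n := by simp [hf]; ring
  have hfi : ∀ i, i ≤ n → q ^ (n + i) + q ^ (n - i) = f i := by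
    intro i hi
    obtain ⟨m, rfl⟩ := Nat.exists_eq_add_of_le hi
    rw [hf, Nat.add_sub_cancel_left]
    simp only [pow_add, inv_pow]
    field_simp
  have hL : ∀ k ∈ Finset.Icc 1 n, (∑ j ∈ Finset.range (n + 1),
      if n = k * (k + 1) / 2 + k * j then
        (-1) ^ k * (q ^ n * ((1 - q) * q ^ j + (1 - q⁻¹) * q⁻¹ ^ j)) else 0) =
      sgi n k 0 * f 0 + ∑ i ∈ Finset.range n, (sgi n k (i + 1) - sgi n k i) * f (i + 1) := by
    intro k hk
    have hk1 := (Finset.mem_Icc.1 hk).1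
    have e : ∀ j, (if n = k * (k + 1) / 2 + k * j then
        (-1) ^ k * (q ^ n * ((1 - q) * q ^ j + (1 - q⁻¹) * q⁻¹ ^ j)) else 0) =
        sgi n k j * f j - sgi n k j * f (j + 1) := by
      intro j
      rw [sgi]
      by_cases h : n = k * (k + 1) / 2 + k * j
      · rw [if_pos h, if_pos ((tri_iff n k j).1 h), hf]
        simp only [pow_succ]
        ring
      · rw [if_neg h, if_neg (fun h' => h ((tri_iff n k j).2 h'))]
        ring
    rw [Finset.sum_congr rfl fun j _ => e j, Finset.sum_sub_distrib, Finset.sum_range_succ',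
      Finset.sum_range_succ (fun j => sgi n k j * f (j + 1)), sgi_zero hk1 (by omega : n < k + n)]
    simp only [sub_mul, Finset.sum_sub_distrib]
    ring
  have hr : ∀ g : ℕ → ℚ, ∑ i ∈ Finset.Icc 1 n, g i = ∑ i ∈ Finset.range n, g (i + 1) := by
    intro g
    rw [Finset.range_eq_Ico, Finset.sum_Ico_add' g 0 n 1]
    rfl
  have h1 := hr (fun k => ∑ j ∈ Finset.range (n + 1), if n = k * (k + 1) / 2 + k * j then
        (-1) ^ k * (q ^ n * ((1 - q) * q ^ j + (1 - q⁻¹) * q⁻¹ ^ j)) else 0)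
  rw [← h1, Finset.sum_congr rfl hL, hr (fun i => (cCoeff n i : ℚ) * (q ^ (n + i) + q ^ (n - i))),
    Finset.sum_add_distrib, Finset.sum_comm, ← Finset.sum_mul, hf0, cCoeff_zero_cast]
  congr 1
  · ring
  · refine Finset.sum_congr rfl fun i hi => ?_
    rw [Finset.mem_range] at hi
    rw [cCoeff_succ_cast, hfi _ (by omega), Finset.sum_mul]

end LaurentCount

theorem number_of_codim_n_ideals_of_laurent_algebra (n : ℕ) (hn : 1 ≤ n)
    (F : Type*) [Field F] [Fintype F] (q : ℕ) (hq : Fintype.card F = q) :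
    {I : Ideal (AddMonoidAlgebra F (ℤ × ℤ)) |
        Module.finrank F (AddMonoidAlgebra F (ℤ × ℤ) ⧸ I) = n}.Finite ∧
      (Nat.card {I : Ideal (AddMonoidAlgebra F (ℤ × ℤ)) //
          Module.finrank F (AddMonoidAlgebra F (ℤ × ℤ) ⧸ I) = n} : ℤ) =
        cCoeff n 0 * (q : ℤ) ^ n +
          ∑ i ∈ Finset.Icc 1 n, cCoeff n i * ((q : ℤ) ^ (n + i) + (q : ℤ) ^ (n - i)) := by
  have hqc : Nat.card F = q := by rw [Nat.card_eq_fintype_card, hq]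
  have hq1 : 1 < q := by rw [← hq]; exact Fintype.one_lt_card
  have hq0 : (q : ℚ) ≠ 0 := by
    have : q ≠ 0 := by omega
    exact_mod_cast this
  obtain ⟨hfin, hcard⟩ := LaurentCount.transfer (F := F) hn
  refine ⟨hfin, ?_⟩
  have hE := LaurentCount.E_series (q : ℚ) (fun d => (Nat.card (LaurentCount.MonSet F d) : ℚ))
    (fun d => (LaurentCount.Ecount F d : ℚ)) (by
      simp only [LaurentCount.card_MonSet_zero, Nat.cast_one]) (by
      intro d
      simp only [LaurentCount.card_MonSet_succ, hqc]
      rw [Nat.cast_mul, Nat.cast_pow, Nat.cast_sub hq1.le, Nat.cast_one]) (by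
      intro d
      have := LaurentCount.Ecount_rec (F := F) d
      rw [hqc] at this
      exact_mod_cast this)
  have hW := LaurentCount.W_prod (q : ℚ) hq0 (fun d => (LaurentCount.Ecount F d : ℚ))
    (fun m n => (Nat.card (LaurentCount.XSet F m n) : ℚ)) hE (by
      intro n
      have := (LaurentCount.XSet_zero (F := F) n).2
      simp only [this]
      push_cast
      rfl) (by
      intro m n
      have := (LaurentCount.XSet_succ (F := F) m (LaurentCount.finite_XSet m) n).2
      simp only [this, hqc]
      push_cast
      rfl) n
  have hco := LaurentCount.coeff_W (q : ℚ) hq0 n hn _ hW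
  rw [LaurentCount.final_sum (q : ℚ) hq0 n hn, PowerSeries.coeff_mk] at hco
  rw [hcard]
  exact_mod_cast hco
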